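/- arXiv:0912.2332 — 9 statements merged into one kernel-verified Lean document; each statement's English description precedes it below -/
import Mathlib

section
/- For every k and all k-element subsets I, J of {1,…,n+1}, every coefficient of the polynomial Δ_{I,J}(M) ∈ ℤ[t_1,…,t_n] is a nonnegative integer. In particular, for the Coxeter element c = s_{i_1}∘⋯∘s_{i_n} of S_{n+1} (where s_i is the transposition (i,i+1)) and any integer m, the minor Δ_{I,I}(M) with I = c^m({1,…,k}), which is the F-polynomial F_{c^m ω_k} in type A_n, has nonnegative integer coefficients. -/
/-!
Type A_n: the minor Δ_{I,J}(M) of M = x̄_{i_1}(1)⋯x̄_{i_n}(1)·x_{i_n}(t_{i_n})⋯x_{i_1}(t_{i_1})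
equals the sum of the weights of all vertex-disjoint path families from I to J.
(For I = J = c^m({1,…,k}) this is the F-polynomial F_{c^m ω_k} in type A_n.)
Indices are zero-based: the element j ∈ {1,…,n+1} of the paper corresponds to
`(j-1 : Fin (n+1))`, and the letter i_t to `w ⟨t-1, _⟩` for a bijection `w : Fin n ≃ Fin n`.
-/

open scoped Classical
open Matrix

noncomputable section

abbrev RA (n : ℕ) := MvPolynomial (Fin n) ℤ

/-- `x_i(r) = Id + r·E_{i,i+1}`. -/
def xA (n : ℕ) (i : Fin n) (r : RA n) : Matrix (Fin (n + 1)) (Fin (n + 1)) (RA n) :=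
  1 + Matrix.single i.castSucc i.succ r

/-- `x̄_i(r) = Id + r·E_{i+1,i}`. -/
def xbarA (n : ℕ) (i : Fin n) (r : RA n) : Matrix (Fin (n + 1)) (Fin (n + 1)) (RA n) :=
  1 + Matrix.single i.succ i.castSucc r

/-- The matrix `M^{(t)}` (zero-based step `t`): `x̄_{i_{t+1}}(1)` for `t < n`,
and `x_{i_{2n-t}}(t_{i_{2n-t}})` for `n ≤ t < 2n`. -/
def stepA (n : ℕ) (w : Fin n ≃ Fin n) (t : Fin (2 * n)) :
    Matrix (Fin (n + 1)) (Fin (n + 1)) (RA n) :=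
  if h : (t : ℕ) < n then xbarA n (w ⟨t, h⟩) 1
  else xA n (w ⟨2 * n - 1 - (t : ℕ), by have := t.isLt; omega⟩)
    (MvPolynomial.X (w ⟨2 * n - 1 - (t : ℕ), by have := t.isLt; omega⟩))

/-- `M = M^{(1)} ⋯ M^{(2n)}`. -/
def MA (n : ℕ) (w : Fin n ≃ Fin n) : Matrix (Fin (n + 1)) (Fin (n + 1)) (RA n) :=
  ((List.finRange (2 * n)).map (stepA n w)).prod

/-- The minor of `M` with row set `I` and column set `J` (rows and columns taken in
increasing order). -/
def minorA {N R : Type*} [Fintype N] [LinearOrder N] [CommRing R]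
    (M : Matrix N N R) {k : ℕ} (I J : Finset N) (hI : I.card = k) (hJ : J.card = k) : R :=
  (Matrix.of fun a b : Fin k => M (I.orderIsoOfFin hI a) (J.orderIsoOfFin hJ b)).det


/-- A matrix is totally positive relative to a subsemiring `S` if every minor with increasing row
and column indices lies in `S`. Weakly increasing index maps are allowed: the additional minors
vanish. -/
def IsTotallyPositiveIn {N R : Type*} [LinearOrder N] [CommRing R] (S : Subsemiring R)
    (M : Matrix N N R) : Prop :=
  ∀ (k : ℕ) (f g : Fin k → N), Monotone f → Monotone g → (M.submatrix f g).det ∈ S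

namespace IsTotallyPositiveIn

variable {N R : Type*} [LinearOrder N] [CommRing R] {S : Subsemiring R} {M : Matrix N N R}

theorem of_strictMono
    (h : ∀ (k : ℕ) (f g : Fin k → N), StrictMono f → StrictMono g → (M.submatrix f g).det ∈ S) :
    IsTotallyPositiveIn S M := by
  intro k f g hf hg
  by_cases hfi : Function.Injective f
  · by_cases hgi : Function.Injective g
    · exact h k f g (hf.strictMono_of_injective hfi) (hg.strictMono_of_injective hgi)
    · obtain ⟨a, b, hab, hne⟩ := Function.not_injective_iff.mp hgi
      rw [Matrix.det_zero_of_column_eq hne fun i => by simp [hab]]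
      exact S.zero_mem
  · obtain ⟨a, b, hab, hne⟩ := Function.not_injective_iff.mp hfi
    rw [Matrix.det_zero_of_row_eq hne (funext fun j => by simp [hab])]
    exact S.zero_mem

theorem one : IsTotallyPositiveIn S (1 : Matrix N N R) := by
  refine of_strictMono fun k f g hf hg => ?_
  by_cases hsub : ∀ a, f a ∈ Set.range g
  · choose σ hσ using hsub
    have hσm : StrictMono σ := fun a b hab => by
      rw [← hg.lt_iff_lt, hσ, hσ]
      exact hf hab
    have hσid : σ = id := by
      refine (hσm.range_inj strictMono_id).mp ?_
      rw [Set.range_id, (Finite.injective_iff_surjective.mp hσm.injective).range_eq]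
    have hfg : f = g := funext fun a => by rw [← hσ a, hσid, id]
    rw [hfg, Matrix.submatrix_one g hg.injective, Matrix.det_one]
    exact S.one_mem
  · push Not at hsub
    obtain ⟨a, ha⟩ := hsub
    rw [Matrix.det_eq_zero_of_row_eq_zero a fun j => ?_]
    · exact S.zero_mem
    · exact Matrix.one_apply_ne fun h => ha ⟨j, h.symm⟩

/-- Replacing a value of a strictly increasing map by a neighbouring value leaves it monotone. -/
theorem monotone_update_of_covBy {k : ℕ} {g : Fin k → N} (hg : StrictMono g) {b : Fin k} {p : N}
    (hp : p ⋖ g b ∨ g b ⋖ p) : Monotone (Function.update g b p) := by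
  intro x y hxy
  rcases hxy.eq_or_lt with rfl | hlt
  · exact le_rfl
  have hg' := hg hlt
  by_cases hx : x = b
  · subst hx
    rw [Function.update_self, Function.update_of_ne hlt.ne']
    rcases hp with hp | hp
    · exact (hp.lt.trans hg').le
    · exact hp.ge_of_gt hg'
  · by_cases hy : y = b
    · subst hy
      rw [Function.update_self, Function.update_of_ne hx]
      rcases hp with hp | hp
      · exact hp.le_of_lt hg'
      · exact (hg'.trans hp.lt).le
    · rw [Function.update_of_ne hx, Function.update_of_ne hy]
      exact hg'.le

theorem mul_one_add_single [Fintype N] (hM : IsTotallyPositiveIn S M) {p q : N}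
    (hpq : p ⋖ q ∨ q ⋖ p) {r : R} (hr : r ∈ S) :
    IsTotallyPositiveIn S (M * (1 + Matrix.single p q r)) := by
  refine of_strictMono fun k f g hf hg => ?_
  have entry_of_ne : ∀ i j, j ≠ q → (M * (1 + Matrix.single p q r)) i j = M i j := by
    intro i j hj
    simp [mul_add, Matrix.mul_single_apply_of_ne, hj]
  have entry_self : ∀ i, (M * (1 + Matrix.single p q r)) i q = M i q + r * M i p := by
    intro i
    simp [mul_add, mul_comm]
  by_cases hq : ∃ b, g b = q
  · obtain ⟨b, rfl⟩ := hq
    have hsub : (M * (1 + Matrix.single p (g b) r)).submatrix f g =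
        (M.submatrix f g).updateCol b
          ((fun i => M (f i) (g b)) + r • fun i => M (f i) p) := by
      ext i j
      by_cases hj : j = b
      · subst hj
        simp [entry_self]
      · simp [hj, entry_of_ne _ _ (hg.injective.ne hj)]
    have hleft : (M.submatrix f g).updateCol b (fun i => M (f i) (g b)) = M.submatrix f g :=
      Matrix.updateCol_eq_self _ _
    have hright : (M.submatrix f g).updateCol b (fun i => M (f i) p) =
        M.submatrix f (Function.update g b p) := by
      ext i j
      by_cases hj : j = b
      · subst hj
        simp
      · simp [hj]
    rw [hsub, Matrix.det_updateCol_add, Matrix.det_updateCol_smul, hleft, hright]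
    exact S.add_mem (hM k f g hf.monotone hg.monotone)
      (S.mul_mem hr (hM k f _ hf.monotone (monotone_update_of_covBy hg hpq)))
  · push Not at hq
    have hsub : (M * (1 + Matrix.single p q r)).submatrix f g = M.submatrix f g := by
      ext i j
      exact entry_of_ne _ _ (hq j)
    rw [hsub]
    exact hM k f g hf.monotone hg.monotone

end IsTotallyPositiveIn

/-- The polynomials with nonnegative integer coefficients. -/
def nonnegCoeffs (σ : Type*) : Subsemiring (MvPolynomial σ ℤ) :=
  (MvPolynomial.map (Nat.castRingHom ℤ)).rangeS

theorem coeff_nonneg_of_mem_nonnegCoeffs {σ : Type*} {f : MvPolynomial σ ℤ}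
    (hf : f ∈ nonnegCoeffs σ) (d : σ →₀ ℕ) : 0 ≤ MvPolynomial.coeff d f := by
  obtain ⟨g, rfl⟩ := hf
  rw [MvPolynomial.coeff_map]
  exact Int.natCast_nonneg _

theorem X_mem_nonnegCoeffs {σ : Type*} (i : σ) : MvPolynomial.X i ∈ nonnegCoeffs σ :=
  ⟨MvPolynomial.X i, MvPolynomial.map_X _ _⟩

theorem castSucc_covBy_succ {n : ℕ} (i : Fin n) : i.castSucc ⋖ i.succ :=
  ⟨i.castSucc_lt_succ, fun _ h h' => h'.not_ge (Fin.castSucc_lt_iff_succ_le.mp h)⟩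

theorem IsTotallyPositiveIn.mul_stepA {n : ℕ} (w : Fin n ≃ Fin n) (t : Fin (2 * n))
    {M : Matrix (Fin (n + 1)) (Fin (n + 1)) (RA n)}
    (hM : IsTotallyPositiveIn (nonnegCoeffs (Fin n)) M) :
    IsTotallyPositiveIn (nonnegCoeffs (Fin n)) (M * stepA n w t) := by
  unfold stepA
  split_ifs
  · exact hM.mul_one_add_single (.inr (castSucc_covBy_succ _)) (Subsemiring.one_mem _)
  · exact hM.mul_one_add_single (.inl (castSucc_covBy_succ _)) (X_mem_nonnegCoeffs _)

theorem isTotallyPositiveIn_MA (n : ℕ) (w : Fin n ≃ Fin n) :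
    IsTotallyPositiveIn (nonnegCoeffs (Fin n)) (MA n w) := by
  unfold MA
  induction List.finRange (2 * n) using List.reverseRecOn with
  | nil => exact .one
  | append_singleton l t ih =>
    rw [List.map_append, List.prod_append, List.map_singleton, List.prod_singleton]
    exact ih.mul_stepA w t

theorem typeA_Fpolynomial_coefficients_nonneg
    (n : ℕ) (hn : 1 ≤ n) (w : Fin n ≃ Fin n)
    (k : ℕ) (I J : Finset (Fin (n + 1))) (hI : I.card = k) (hJ : J.card = k)
    (d : Fin n →₀ ℕ) :
    0 ≤ MvPolynomial.coeff d (minorA (MA n w) I J hI hJ) := by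
  exact coeff_nonneg_of_mem_nonnegCoeffs (isTotallyPositiveIn_MA n w k _ _
    (fun _ _ h => (I.orderIsoOfFin hI).monotone h)
    (fun _ _ h => (J.orderIsoOfFin hJ).monotone h)) d
end
end

section
/- For every k ∈ {1,…,n−2} and every integer m, every coefficient of the polynomial Δ_{I,I}(M) ∈ ℤ[t_1,…,t_n], where I = c^m({1,…,k}), is a nonnegative integer. (This polynomial is the F-polynomial F_{c^m ω_k} in type D_n; in particular these F-polynomials have positive coefficients.) -/
/-!
Type D_n setup. The index set Ω = {1,…,n, \bar n,…,\bar 1} (ordered 1<⋯<n<\bar n<⋯<\bar 1)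
is identified with `Fin (2*n)` in a zero-based way: the element j corresponds to `j-1` and
\bar j to `2*n-j`. The letter i_t of the word corresponds to `w ⟨t-1, _⟩` (zero-based letters:
the simple root α_i corresponds to `i-1 : Fin n`) for a bijection `w : Fin n ≃ Fin n`.
-/

open scoped Classical
open Matrix

noncomputable section

abbrev RD (n : ℕ) := MvPolynomial (Fin n) ℤ

/-- The matrix `e_i` of type D_n (zero-based `u = i-1`):
for i ≤ n-1, `e_i = E_{i,i+1} + E_{\bar{i+1},\bar i}`; `e_n = E_{n-1,\bar n} + E_{n,\bar{n-1}}`. -/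
def eD (n : ℕ) (hn : 4 ≤ n) (u : Fin n) : Matrix (Fin (2 * n)) (Fin (2 * n)) (RD n) :=
  if _h : (u : ℕ) < n - 1 then
    Matrix.single ⟨u, by have := u.isLt; omega⟩ ⟨(u : ℕ) + 1, by have := u.isLt; omega⟩ 1 +
    Matrix.single ⟨2 * n - 2 - (u : ℕ), by omega⟩ ⟨2 * n - 1 - (u : ℕ), by omega⟩ 1
  else
    Matrix.single ⟨n - 2, by omega⟩ ⟨n, by omega⟩ 1 +
    Matrix.single ⟨n - 1, by omega⟩ ⟨n + 1, by omega⟩ 1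

/-- The matrix `M^{(t)}` (zero-based step `t`): `x̄_{i_{t+1}}(1) = Id + f_{i_{t+1}}` for `t < n`
(where `f_i = e_iᵀ`), and `x_{i_{2n-t}}(t_{i_{2n-t}}) = Id + t_{i_{2n-t}}·e_{i_{2n-t}}`
for `n ≤ t < 2n`. -/
def stepD (n : ℕ) (hn : 4 ≤ n) (w : Fin n ≃ Fin n) (t : Fin (2 * n)) :
    Matrix (Fin (2 * n)) (Fin (2 * n)) (RD n) :=
  if h : (t : ℕ) < n then 1 + (eD n hn (w ⟨t, h⟩))ᵀ
  else 1 + (MvPolynomial.X (w ⟨2 * n - 1 - (t : ℕ), by have := t.isLt; omega⟩) : RD n) •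
    eD n hn (w ⟨2 * n - 1 - (t : ℕ), by have := t.isLt; omega⟩)

/-- `M = M^{(1)} ⋯ M^{(2n)}`. -/
def MD (n : ℕ) (hn : 4 ≤ n) (w : Fin n ≃ Fin n) : Matrix (Fin (2 * n)) (Fin (2 * n)) (RD n) :=
  ((List.finRange (2 * n)).map (stepD n hn w)).prod

/-- The simple reflection `s_i` of the Weyl group of type D_n acting on Ω (zero-based `u = i-1`):
for i ≤ n-1, `s_i = (i,i+1)(\bar{i+1},\bar i)`; `s_n = (n-1,\bar n)(n,\bar{n-1})`. -/
def sD (n : ℕ) (hn : 4 ≤ n) (u : Fin n) : Equiv.Perm (Fin (2 * n)) :=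
  if _h : (u : ℕ) < n - 1 then
    Equiv.swap ⟨u, by have := u.isLt; omega⟩ ⟨(u : ℕ) + 1, by have := u.isLt; omega⟩ *
    Equiv.swap ⟨2 * n - 2 - (u : ℕ), by omega⟩ ⟨2 * n - 1 - (u : ℕ), by omega⟩
  else
    Equiv.swap ⟨n - 2, by omega⟩ ⟨n, by omega⟩ * Equiv.swap ⟨n - 1, by omega⟩ ⟨n + 1, by omega⟩

/-- The Coxeter element `c = s_{i_1} ∘ ⋯ ∘ s_{i_n}`. -/
def cD (n : ℕ) (hn : 4 ≤ n) (w : Fin n ≃ Fin n) : Equiv.Perm (Fin (2 * n)) :=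
  ((List.finRange n).map fun t => sD n hn (w t)).prod

/-- The subset {1,…,k} of Ω (zero-based: the first k indices). -/
def initSeg (N k : ℕ) : Finset (Fin N) := Finset.filter (fun j => (j : ℕ) < k) Finset.univ

/-- The minor of `M` with row set `I` and column set `J` (rows and columns taken in
increasing order). -/
def minorD {N R : Type*} [Fintype N] [LinearOrder N] [CommRing R]
    (M : Matrix N N R) {k : ℕ} (I J : Finset N) (hI : I.card = k) (hJ : J.card = k) : R :=
  (Matrix.of fun a b : Fin k => M (I.orderIsoOfFin hI a) (J.orderIsoOfFin hJ b)).det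

/-- A vertex-disjoint path family from `I` to `J`. -/
def IsPathFamilyD (n k : ℕ) (I J : Finset (Fin (2 * n)))
    (p : Fin k → Fin (2 * n + 1) → Fin (2 * n)) : Prop :=
  (∀ t, Function.Injective fun a => p a t) ∧
  Finset.image (fun a => p a 0) Finset.univ = I ∧
  Finset.image (fun a => p a (Fin.last (2 * n))) Finset.univ = J

/-- The weight of a path family. -/
def weightD (n : ℕ) (hn : 4 ≤ n) (w : Fin n ≃ Fin n) (k : ℕ)
    (p : Fin k → Fin (2 * n + 1) → Fin (2 * n)) : RD n :=
  ∏ a : Fin k, ∏ t : Fin (2 * n), stepD n hn w t (p a t.castSucc) (p a t.succ)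

/-- A symmetrized form of the Cauchy–Binet formula. -/
theorem factorial_mul_det_mul_transpose {ι N R : Type*} [Fintype ι] [DecidableEq ι] [Fintype N]
    [DecidableEq N] [CommRing R] (B C : Matrix ι N R) :
    ((Fintype.card ι).factorial : R) * (B * Cᵀ).det =
      ∑ φ : ι → N, (B.submatrix id φ).det * (C.submatrix id φ).det := by
  have expand : (B * Cᵀ).det = ∑ φ : ι → N, (∏ a, B a (φ a)) * (C.submatrix id φ).det := by
    have hrow : B * Cᵀ = fun a => ∑ j, B a j • Cᵀ j := by
      ext a b
      simp [Matrix.mul_apply, Finset.sum_apply]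
    change (Matrix.detRowAlternating : (ι → R) [⋀^ι]→ₗ[R] R).toMultilinearMap (B * Cᵀ) = _
    rw [hrow, MultilinearMap.map_sum]
    refine Finset.sum_congr rfl fun φ _ => ?_
    rw [MultilinearMap.map_smul_univ, smul_eq_mul, ← Matrix.det_transpose (C.submatrix id φ)]
    rfl
  have reindex (σ : Equiv.Perm ι) : (B * Cᵀ).det =
      ∑ φ : ι → N, (Equiv.Perm.sign σ : R) * (∏ a, B a (φ (σ a))) * (C.submatrix id φ).det := by
    rw [expand, ← (Equiv.arrowCongr σ⁻¹ (Equiv.refl N)).sum_comp]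
    refine Finset.sum_congr rfl fun φ _ => ?_
    have h : (C.submatrix id φ).submatrix id σ = C.submatrix id (fun a => φ (σ a)) := rfl
    change (∏ a, B a (φ (σ a))) * (C.submatrix id (fun a => φ (σ a))).det = _
    rw [← h, Matrix.det_permute']
    ring
  calc ((Fintype.card ι).factorial : R) * (B * Cᵀ).det
      = ∑ _σ : Equiv.Perm ι, (B * Cᵀ).det := by
        rw [Finset.sum_const, Finset.card_univ, Fintype.card_perm, nsmul_eq_mul]
    _ = _ := by
        rw [Finset.sum_congr rfl fun σ _ => reindex σ, Finset.sum_comm]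
        refine Finset.sum_congr rfl fun φ _ => ?_
        rw [← Finset.sum_mul, ← Matrix.det_transpose (B.submatrix id φ),
          Matrix.det_apply' (B.submatrix id φ)ᵀ]
        rfl

namespace MvPolynomial

section EvalOne

variable {σ M : Type*} [AddCommMonoid M] {wt : σ → M} {R : Type*} [CommRing R]

theorem IsWeightedHomogeneous.coeff_eq_eval_one [DecidableEq σ]
    (hwt : Function.Injective (Finsupp.weight (R := ℕ) wt)) {p : MvPolynomial σ R} {m : M}
    (hp : IsWeightedHomogeneous wt p m) {d : σ →₀ ℕ} (hd : coeff d p ≠ 0) :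
    coeff d p = eval (fun _ => 1) p := by
  have h : p = monomial d (coeff d p) := by
    ext d'
    rw [coeff_monomial]
    split_ifs with h
    · rw [h]
    · by_contra h'
      exact h (hwt ((hp hd).trans (hp h').symm))
  conv_rhs => rw [h]
  simp [eval_monomial]

theorem IsWeightedHomogeneous.coeff_C_eval_one_mul_nonneg [LinearOrder R] [IsStrictOrderedRing R]
    (hwt : Function.Injective (Finsupp.weight (R := ℕ) wt)) {p : MvPolynomial σ R} {m : M}
    (hp : IsWeightedHomogeneous wt p m) (d : σ →₀ ℕ) :
    0 ≤ coeff d (C (eval (fun _ => 1) p) * p) := by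
  classical
  rw [coeff_C_mul]
  rcases eq_or_ne (coeff d p) 0 with h | h
  · simp [h]
  · rw [← hp.coeff_eq_eval_one hwt h]
    exact mul_self_nonneg _

end EvalOne

/-- The entry `(i, j)` of `A` is weighted homogeneous of degree `h j - h i`. -/
def IsGradedMatrix {σ M R N : Type*} [AddCommGroup M] [CommRing R] (wt : σ → M) (h : N → M)
    (A : Matrix N N (MvPolynomial σ R)) : Prop :=
  ∀ i j, IsWeightedHomogeneous wt (A i j) (h j - h i)

section Graded

variable {σ M R N : Type*} [AddCommGroup M] [CommRing R] {wt : σ → M} {h : N → M}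

theorem IsGradedMatrix.one [DecidableEq N] :
    IsGradedMatrix wt h (1 : Matrix N N (MvPolynomial σ R)) := by
  intro i j
  rw [Matrix.one_apply]
  split_ifs with hij
  · rw [hij, sub_self]
    exact isWeightedHomogeneous_one R wt
  · exact isWeightedHomogeneous_zero R wt _

theorem IsGradedMatrix.add {A B : Matrix N N (MvPolynomial σ R)}
    (hA : IsGradedMatrix wt h A) (hB : IsGradedMatrix wt h B) : IsGradedMatrix wt h (A + B) :=
  fun i j => (hA i j).add (hB i j)

theorem IsGradedMatrix.single [DecidableEq N] {i j : N} {p : MvPolynomial σ R}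
    (hp : IsWeightedHomogeneous wt p (h j - h i)) : IsGradedMatrix wt h (Matrix.single i j p) := by
  intro a b
  rw [Matrix.single_apply]
  split_ifs with hab
  · rwa [← hab.1, ← hab.2]
  · exact isWeightedHomogeneous_zero R wt _

theorem IsGradedMatrix.det_submatrix {ι : Type*} [Fintype ι] [DecidableEq ι]
    {A : Matrix N N (MvPolynomial σ R)} (hA : IsGradedMatrix wt h A) (r c : ι → N) :
    IsWeightedHomogeneous wt (A.submatrix r c).det (∑ a, h (c a) - ∑ a, h (r a)) := by
  rw [Matrix.det_apply']
  refine IsWeightedHomogeneous.sum _ _ _ fun τ _ => ?_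
  have hτ : ∑ a, h (c a) - ∑ a, h (r a) = ∑ a, (h (c a) - h (r (τ a))) := by
    rw [Finset.sum_sub_distrib, Equiv.sum_comp τ fun a => h (r a)]
  have hsign : ((Equiv.Perm.sign τ : ℤ) : MvPolynomial σ R) = C ((Equiv.Perm.sign τ : ℤ) : R) := by
    simp
  rw [hτ, hsign]
  exact (IsWeightedHomogeneous.prod _ _ _ fun a _ => hA _ _).C_mul _

variable [Fintype N]

theorem IsGradedMatrix.mul {A B : Matrix N N (MvPolynomial σ R)}
    (hA : IsGradedMatrix wt h A) (hB : IsGradedMatrix wt h B) : IsGradedMatrix wt h (A * B) := by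
  intro i j
  rw [Matrix.mul_apply]
  refine IsWeightedHomogeneous.sum _ _ _ fun l _ => ?_
  have := (hA i l).mul (hB l j)
  rwa [add_comm, sub_add_sub_cancel] at this

theorem IsGradedMatrix.list_prod [DecidableEq N] {L : List (Matrix N N (MvPolynomial σ R))}
    (hL : ∀ A ∈ L, IsGradedMatrix wt h A) : IsGradedMatrix wt h L.prod :=
  List.prod_induction _ (fun _ _ => IsGradedMatrix.mul) IsGradedMatrix.one hL

/-- Principal minors of `A(1) * A(x)ᵀ` have nonnegative coefficients, for `A` graded. -/
theorem IsGradedMatrix.coeff_det_submatrix_nonneg [LinearOrder R] [IsStrictOrderedRing R]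
    {ι : Type*} [Fintype ι] [DecidableEq ι]
    (hwt : Function.Injective (Finsupp.weight (R := ℕ) wt))
    {A : Matrix N N (MvPolynomial σ R)} (hA : IsGradedMatrix wt h A) (r : ι → N) (d : σ →₀ ℕ) :
    0 ≤ coeff d (((A.map (C.comp (eval fun _ => 1)) * Aᵀ).submatrix r r).det) := by
  classical
  have key := factorial_mul_det_mul_transpose
    ((A.map (C.comp (eval fun _ => 1))).submatrix r id) (A.submatrix r id)
  rw [Matrix.transpose_submatrix, ← Matrix.submatrix_mul _ _ _ _ _ Function.bijective_id] at key
  have hsum := congrArg (coeff d) key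
  rw [coeff_sum, ← map_natCast (C : R →+* MvPolynomial σ R), coeff_C_mul] at hsum
  refine nonneg_of_mul_nonneg_right (a := ((Fintype.card ι).factorial : R)) ?_
    (by exact_mod_cast Nat.factorial_pos _)
  rw [hsum]
  refine Finset.sum_nonneg fun φ _ => ?_
  have hmap : (((A.map ((C : R →+* MvPolynomial σ R).comp (eval fun _ => 1))).submatrix r id).submatrix id φ).det =
        C (eval (fun _ => 1) (A.submatrix r φ).det) := by
    rw [← RingHom.comp_apply (C : R →+* MvPolynomial σ R), RingHom.map_det]
    rfl
  rw [hmap]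
  exact (hA.det_submatrix r φ).coeff_C_eval_one_mul_nonneg hwt d

end Graded

end MvPolynomial

open MvPolynomial

/-- The lower unitriangular product `∏ (1 + t_{i_s} f_{i_s})`. -/
def lowerD (n : ℕ) (hn : 4 ≤ n) (w : Fin n ≃ Fin n) : Matrix (Fin (2 * n)) (Fin (2 * n)) (RD n) :=
  ((List.finRange n).map fun s => 1 + (X (w s) : RD n) • (eD n hn (w s))ᵀ).prod

/-- Twice the pairing of the `u`-th fundamental coweight with the weight of the `j`-th basis
vector. -/
def coweightD (n : ℕ) (j : Fin (2 * n)) (u : Fin n) : ℤ :=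
  if (u : ℕ) < n - 2 then
    if (j : ℕ) ≤ u then 2 else if 2 * n - 1 - (u : ℕ) ≤ j then -2 else 0
  else if (u : ℕ) = n - 2 then
    if (j : ℕ) ≤ n - 2 ∨ (j : ℕ) = n then 1 else -1
  else if (j : ℕ) < n then 1 else -1

theorem weight_pi_single_two_injective (n : ℕ) : Function.Injective
    (Finsupp.weight (R := ℕ) fun u : Fin n => (Pi.single u 2 : Fin n → ℤ)) := by
  intro d d' h
  ext u
  have := congrFun h u
  simpa [Finsupp.weight_eq_sum, Finset.sum_apply, Pi.single_apply] using this

theorem isGradedMatrix_smul_eD_transpose (n : ℕ) (hn : 4 ≤ n) (u : Fin n) :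
    IsGradedMatrix (fun u : Fin n => (Pi.single u 2 : Fin n → ℤ)) (coweightD n)
      ((X u : RD n) • (eD n hn u)ᵀ) := by
  have hX {i j : Fin (2 * n)} (hij : coweightD n j - coweightD n i = Pi.single u 2) :
      IsGradedMatrix (fun u : Fin n => (Pi.single u 2 : Fin n → ℤ)) (coweightD n)
        ((X u : RD n) • Matrix.single i j (1 : RD n)) := by
    rw [Matrix.smul_single, smul_eq_mul, mul_one]
    refine IsGradedMatrix.single ?_
    rw [hij]
    exact isWeightedHomogeneous_X ℤ (fun u : Fin n => (Pi.single u 2 : Fin n → ℤ)) u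
  unfold eD
  split_ifs with h <;>
  · rw [Matrix.transpose_add, Matrix.transpose_single, Matrix.transpose_single, smul_add]
    refine (hX ?_).add (hX ?_) <;>
    · funext v
      simp only [coweightD, Pi.sub_apply, Pi.single_apply, Fin.ext_iff, or_true, if_true]
      have hu := u.isLt
      have hv := v.isLt
      split_ifs <;> omega

theorem isGradedMatrix_lowerD (n : ℕ) (hn : 4 ≤ n) (w : Fin n ≃ Fin n) :
    IsGradedMatrix (fun u : Fin n => (Pi.single u 2 : Fin n → ℤ)) (coweightD n)
      (lowerD n hn w) := by
  refine IsGradedMatrix.list_prod fun A hA => ?_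
  obtain ⟨s, -, rfl⟩ := List.mem_map.1 hA
  exact IsGradedMatrix.one.add (isGradedMatrix_smul_eD_transpose n hn (w s))

theorem map_eD (n : ℕ) (hn : 4 ≤ n) (u : Fin n) (f : RD n →+* RD n) :
    (eD n hn u).map f = eD n hn u := by
  unfold eD
  split_ifs <;> simp [Matrix.map_add]

theorem MD_eq (n : ℕ) (hn : 4 ≤ n) (w : Fin n ≃ Fin n) :
    MD n hn w = (lowerD n hn w).map (C.comp (eval fun _ => 1)) * (lowerD n hn w)ᵀ := by
  have hsplit : (List.finRange (2 * n)).map (stepD n hn w) =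
      ((List.finRange n).map fun s => 1 + (eD n hn (w s))ᵀ) ++
        (((List.finRange n).map fun s =>
          (1 + (X (w s) : RD n) • (eD n hn (w s))ᵀ)).map Matrix.transpose).reverse := by
    refine List.ext_getElem (by simp; omega) fun t h₁ h₂ => ?_
    rw [List.getElem_append]
    split_ifs with ht
    · have ht' : t < n := by simpa using ht
      simp [stepD, ht']
    · have ht' : ¬ t < n := by simpa using ht
      have hidx : n - 1 - (t - n) = 2 * n - 1 - t := by omega
      simp [stepD, ht', hidx]
  have hmap : (lowerD n hn w).map (C.comp (eval fun _ => 1)) =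
      ((List.finRange n).map fun s => 1 + (eD n hn (w s))ᵀ).prod := by
    rw [← RingHom.mapMatrix_apply, lowerD, map_list_prod, List.map_map]
    congr 2
    funext s
    have hs : RingHom.mapMatrix (C.comp (eval fun _ => 1)) ((X (w s) : RD n) • (eD n hn (w s))ᵀ) =
        (eD n hn (w s))ᵀ := by
      conv_rhs => rw [← map_eD n hn (w s) (C.comp (eval fun _ => 1))]
      ext1 i j
      simp
    rw [Function.comp_apply, map_add, map_one, hs]
  rw [MD, hsplit, List.prod_append, hmap, lowerD, Matrix.transpose_list_prod]

theorem typeD_Fpolynomial_coefficients_nonneg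
    (n : ℕ) (hn : 4 ≤ n) (w : Fin n ≃ Fin n)
    (k : ℕ) (hk1 : 1 ≤ k) (hk2 : k ≤ n - 2) (m : ℤ)
    (I : Finset (Fin (2 * n)))
    (hIdef : I = (initSeg (2 * n) k).image ⇑(cD n hn w ^ m))
    (hI : I.card = k) (d : Fin n →₀ ℕ) :
    0 ≤ MvPolynomial.coeff d (minorD (MD n hn w) I I hI hI) := by
  unfold minorD
  rw [MD_eq]
  exact (isGradedMatrix_lowerD n hn w).coeff_det_submatrix_nonneg
    (weight_pi_single_two_injective n) (fun a => (I.orderIsoOfFin hI a : Fin (2 * n))) d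
end
end

section
/- Let a, b, d ∈ {1,…,n} be the positions in the word (i_1,…,i_n) with i_a = n, i_b = n−1 and i_d = n−2. If d does not lie strictly between a and b, then the Coxeter element c of type D_n satisfies c(n) = \bar n and c(\bar n) = n (the indices n and \bar n form a single two-cycle of c). Consequently, for every integer m and every k ∈ {1,…,n−2}, the set c^m({1,…,k}) contains neither n nor \bar n. -/
/-!
Type D_n setup. The index set Ω = {1,…,n, \bar n,…,\bar 1} (ordered 1<⋯<n<\bar n<⋯<\bar 1)
is identified with `Fin (2*n)` in a zero-based way: the element j corresponds to `j-1` and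
\bar j to `2*n-j`. The letter i_t of the word corresponds to `w ⟨t-1, _⟩` (zero-based letters:
the simple root α_i corresponds to `i-1 : Fin n`) for a bijection `w : Fin n ≃ Fin n`.
-/

open scoped Classical
open Matrix

noncomputable section

theorem prod_finRange_map_apply {α : Type*} {n : ℕ} (f : Fin n → Equiv.Perm α) (v : ℕ → α)
    (h : ∀ t : Fin n, f t (v (t + 1)) = v t) :
    ((List.finRange n).map f).prod (v n) = v 0 := by
  induction n generalizing v with
  | zero => simp
  | succ n ih =>
    have key := ih (fun t => f t.succ) (fun k => v (k + 1)) fun t => by simpa using h t.succ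
    have h0 : f 0 (v 1) = v 0 := by simpa using h 0
    rw [List.finRange_succ, List.map_cons, List.map_map, List.prod_cons, Equiv.Perm.mul_apply,
      ← h0]
    exact congrArg (f 0) key

/-- The trajectory of `x` under a product of permutations in which only the factors at positions
`q` and then `p` act nontrivially. -/
theorem prod_finRange_map_apply_of_two {α : Type*} {n : ℕ} (f : Fin n → Equiv.Perm α)
    {p q : Fin n} (hpq : p < q) {x y z : α} (hq : f q x = y) (hp : f p y = z)
    (hx : ∀ t, q < t → f t x = x) (hy : ∀ t, p < t → t < q → f t y = y)
    (hz : ∀ t, t < p → f t z = z) :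
    ((List.finRange n).map f).prod x = z := by
  have key := prod_finRange_map_apply f
    (fun k => if k ≤ (p : ℕ) then z else if k ≤ (q : ℕ) then y else x) fun t => by
      rcases lt_trichotomy t p with h | rfl | h
      · have h1 : (t : ℕ) + 1 ≤ p := h
        have h2 : (t : ℕ) ≤ p := by omega
        simp [h1, h2, hz t h]
      · have h1 : (t : ℕ) + 1 ≤ q := hpq
        simp [h1, hp]
      · have h1 : ¬ (t : ℕ) + 1 ≤ p := by have : (p : ℕ) < t := h; omega
        have h2 : ¬ (t : ℕ) ≤ p := by have : (p : ℕ) < t := h; omega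
        rcases lt_trichotomy t q with h' | rfl | h'
        · have h3 : (t : ℕ) + 1 ≤ q := h'
          have h4 : (t : ℕ) ≤ q := by omega
          simp only [h1, h2, h3, h4, if_true, if_false, hy t h h']
        · simpa [h1, h2] using hq
        · have h3 : ¬ (t : ℕ) + 1 ≤ q := by have : (q : ℕ) < t := h'; omega
          have h4 : ¬ (t : ℕ) ≤ q := by have : (q : ℕ) < t := h'; omega
          simp only [h1, h2, h3, h4, if_false, hx t h']
  have h1 : ¬ n ≤ (p : ℕ) := by omega
  have h2 : ¬ n ≤ (q : ℕ) := by omega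
  simpa only [h1, h2, if_false, Nat.zero_le, if_true] using key

/-- The values of `sD`, described on the underlying natural numbers. -/
theorem sD_apply_val (n : ℕ) (hn : 4 ≤ n) (u : Fin n) (x : Fin (2 * n)) :
    ((sD n hn u x : Fin (2 * n)) : ℕ) =
      if (u : ℕ) < n - 1 then
        if (x : ℕ) = u then (u : ℕ) + 1 else if (x : ℕ) = u + 1 then (u : ℕ)
        else if (x : ℕ) = 2 * n - 2 - u then 2 * n - 1 - u
        else if (x : ℕ) = 2 * n - 1 - u then 2 * n - 2 - u else x
      else
        if (x : ℕ) = n - 2 then n else if (x : ℕ) = n then n - 2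
        else if (x : ℕ) = n - 1 then n + 1 else if (x : ℕ) = n + 1 then n - 1 else x := by
  have hu := u.isLt
  unfold sD
  split_ifs <;>
    simp only [Equiv.Perm.mul_apply, Equiv.swap_apply_def, Fin.ext_iff] <;>
    split_ifs <;> simp_all only <;> omega

theorem notMem_image_zpow_of_two_cycle {α : Type*} [DecidableEq α] {c : Equiv.Perm α} {x y : α}
    (hxy : c x = y) (hyx : c y = x) {S : Finset α} (hx : x ∉ S) (hy : y ∉ S) (m : ℤ) :
    x ∉ S.image ⇑(c ^ m) := by
  intro h
  obtain ⟨z, hz, hzx⟩ := Finset.mem_image.mp h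
  have hz' : (c ^ (-m)) x = z := by rw [← hzx, ← Equiv.Perm.mul_apply, ← _root_.zpow_add]; simp
  rcases Equiv.Perm.zpow_apply_eq_of_apply_apply_eq_self (by rw [hxy, hyx]) (-m) with h' | h'
  · exact hx (by rwa [← h', hz'])
  · exact hy (by rwa [← hxy, ← h', hz'])

theorem typeD_coxeter_two_cycle_n_barn
    (n : ℕ) (hn : 4 ≤ n) (w : Fin n ≃ Fin n)
    -- a, b, d are the positions of the letters n, n-1, n-2 in the word (zero-based letters
    -- n-1, n-2, n-3)
    (a b d : Fin n)
    (ha : w a = ⟨n - 1, by omega⟩) (hb : w b = ⟨n - 2, by omega⟩)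
    (hd : w d = ⟨n - 3, by omega⟩)
    -- d does not lie strictly between a and b
    (hbetween : ¬ ((a < d ∧ d < b) ∨ (b < d ∧ d < a))) :
    cD n hn w ⟨n - 1, by omega⟩ = ⟨n, by omega⟩ ∧
    cD n hn w ⟨n, by omega⟩ = ⟨n - 1, by omega⟩ ∧
    ∀ (m : ℤ) (k : ℕ), 1 ≤ k → k ≤ n - 2 →
      (⟨n - 1, by omega⟩ : Fin (2 * n)) ∉ (initSeg (2 * n) k).image ⇑(cD n hn w ^ m) ∧
      (⟨n, by omega⟩ : Fin (2 * n)) ∉ (initSeg (2 * n) k).image ⇑(cD n hn w ^ m) := by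
  have hne : a ≠ b := by
    rintro rfl
    have := congrArg Fin.val (ha.symm.trans hb)
    simp only at this
    omega
  have ne_val : ∀ (t e : Fin n) (m : ℕ) (hm : m < n), w e = ⟨m, hm⟩ → t ≠ e → (w t : ℕ) ≠ m := by
    intro t e m hm he hte h
    exact hte (w.injective ((Fin.ext h : w t = ⟨m, hm⟩).trans he.symm))
  have two_step : cD n hn w ⟨n - 1, by omega⟩ = ⟨n, by omega⟩ ∧
      cD n hn w ⟨n, by omega⟩ = ⟨n - 1, by omega⟩ := by
    have fixed : ∀ t, t ≠ a → t ≠ b → ∀ x : Fin (2 * n), (x : ℕ) = n - 1 ∨ (x : ℕ) = n →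
        sD n hn (w t) x = x := by
      intro t hta htb x hx
      have h1 := ne_val t a _ _ ha hta
      have h2 := ne_val t b _ _ hb htb
      have h3 := (w t).isLt
      apply Fin.ext
      rw [sD_apply_val]
      split_ifs <;> omega
    have fixed' : ∀ t, t ≠ a → t ≠ b → t ≠ d → ∀ x : Fin (2 * n),
        (x : ℕ) = n - 2 ∨ (x : ℕ) = n + 1 → sD n hn (w t) x = x := by
      intro t hta htb htd x hx
      have h1 := ne_val t a _ _ ha hta
      have h2 := ne_val t b _ _ hb htb
      have h3 := ne_val t d _ _ hd htd
      have h4 := (w t).isLt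
      apply Fin.ext
      rw [sD_apply_val]
      split_ifs <;> omega
    have ha' : (w a : ℕ) = n - 1 := congrArg Fin.val ha
    have hb' : (w b : ℕ) = n - 2 := congrArg Fin.val hb
    have hs : ∀ (t : Fin n) (x y : ℕ) (hx : x < 2 * n) (hy : y < 2 * n),
        ((sD n hn (w t) ⟨x, hx⟩ : Fin (2 * n)) : ℕ) = y → sD n hn (w t) ⟨x, hx⟩ = ⟨y, hy⟩ :=
      fun t x y hx hy h => Fin.ext h
    rcases lt_or_gt_of_ne hne with hab | hba
    · refine ⟨prod_finRange_map_apply_of_two _ hab (y := ⟨n - 2, by omega⟩) ?_ ?_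
          (fun t ht => fixed t (hab.trans ht).ne' ht.ne' _ (by simp))
          (fun t h1 h2 => fixed' t h1.ne' h2.ne
            (by rintro rfl; exact hbetween (.inl ⟨h1, h2⟩)) _ (by simp))
          (fun t ht => fixed t ht.ne (ht.trans hab).ne _ (by simp)),
        prod_finRange_map_apply_of_two _ hab (y := ⟨n + 1, by omega⟩) ?_ ?_
          (fun t ht => fixed t (hab.trans ht).ne' ht.ne' _ (by simp))
          (fun t h1 h2 => fixed' t h1.ne' h2.ne
            (by rintro rfl; exact hbetween (.inl ⟨h1, h2⟩)) _ (by simp))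
          (fun t ht => fixed t ht.ne (ht.trans hab).ne _ (by simp))⟩ <;>
      · apply hs
        rw [sD_apply_val]
        dsimp only
        split_ifs <;> omega
    · refine ⟨prod_finRange_map_apply_of_two _ hba (y := ⟨n + 1, by omega⟩) ?_ ?_
          (fun t ht => fixed t ht.ne' (LT.lt.trans hba ht).ne' _ (by simp))
          (fun t h1 h2 => fixed' t h2.ne h1.ne'
            (by rintro rfl; exact hbetween (.inr ⟨h1, h2⟩)) _ (by simp))
          (fun t ht => fixed t (ht.trans hba).ne ht.ne _ (by simp)),
        prod_finRange_map_apply_of_two _ hba (y := ⟨n - 2, by omega⟩) ?_ ?_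
          (fun t ht => fixed t ht.ne' (LT.lt.trans hba ht).ne' _ (by simp))
          (fun t h1 h2 => fixed' t h2.ne h1.ne'
            (by rintro rfl; exact hbetween (.inr ⟨h1, h2⟩)) _ (by simp))
          (fun t ht => fixed t (ht.trans hba).ne ht.ne _ (by simp))⟩ <;>
      · apply hs
        rw [sD_apply_val]
        dsimp only
        split_ifs <;> omega
  obtain ⟨h1, h2⟩ := two_step
  refine ⟨h1, h2, fun m k _ hk => ?_⟩
  constructor
  · exact notMem_image_zpow_of_two_cycle h1 h2 (by simp [initSeg]; omega)
      (by simp [initSeg]; omega) m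
  · exact notMem_image_zpow_of_two_cycle h2 h1 (by simp [initSeg]; omega)
      (by simp [initSeg]; omega) m
end
end

section
/- Let a, b, d ∈ {1,…,n} be the positions in the word (i_1,…,i_n) with i_a = n, i_b = n−1 and i_d = n−2. If d lies strictly between a and b, then the Coxeter element c of type D_n satisfies c(n−1) = \overline{n−1} and c(\overline{n−1}) = n−1 (the indices n−1 and \overline{n−1} form a single two-cycle of c). Consequently, for every integer m and every k ∈ {1,…,n−2}, the set c^m({1,…,k}) contains neither n−1 nor \overline{n−1}. -/
/-!
Type D_n setup. The index set Ω = {1,…,n, \bar n,…,\bar 1} (ordered 1<⋯<n<\bar n<⋯<\bar 1)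
is identified with `Fin (2*n)` in a zero-based way: the element j corresponds to `j-1` and
\bar j to `2*n-j`. The letter i_t of the word corresponds to `w ⟨t-1, _⟩` (zero-based letters:
the simple root α_i corresponds to `i-1 : Fin n`) for a bijection `w : Fin n ≃ Fin n`.
-/

open scoped Classical
open Matrix

noncomputable section

theorem prod_map_finRange_apply_of_path {X : Type*} (n : ℕ) (f : Fin n → Equiv.Perm X)
    (g : ℕ → X) (h : ∀ t : Fin n, f t (g (t + 1)) = g t) :
    ((List.finRange n).map f).prod (g n) = g 0 := by
  induction n generalizing g with
  | zero => simp
  | succ n ih =>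
    have := ih (fun t => f t.succ) (fun t => g (t + 1)) fun t => by simpa using h t.succ
    rw [List.finRange_succ, List.map_cons, List.prod_cons, List.map_map, Equiv.Perm.mul_apply]
    exact (congrArg (f 0) this).trans (by simpa using h 0)

/-- A product of permutations in which only the factors at positions `p < q` move the
trajectory `x ↦ y ↦ z` sends `x` to `z`. -/
theorem prod_map_finRange_apply_of_two_moves {X : Type*} {n : ℕ} (f : Fin n → Equiv.Perm X)
    {p q : Fin n} (hpq : p < q) {x y z : X} (hx : ∀ t, q < t → f t x = x) (hq : f q x = y)
    (hy : ∀ t, p < t → t < q → f t y = y) (hp : f p y = z) (hz : ∀ t, t < p → f t z = z) :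
    ((List.finRange n).map f).prod x = z := by
  have key := prod_map_finRange_apply_of_path n f
    (fun t => if t ≤ p then z else if t ≤ q then y else x) fun t => by
      rcases lt_trichotomy t p with h | rfl | h
      · simp [hz t h, show (t : ℕ) + 1 ≤ p from h, h.le]
      · simp [hp, show (t : ℕ) + 1 ≤ q from hpq]
      · have h1 : ¬ (t : ℕ) ≤ p := by simpa using h
        have h2 : ¬ (t : ℕ) + 1 ≤ p := by omega
        rcases lt_trichotomy t q with h' | rfl | h'
        · simp [hy t h h', h, h2, show (t : ℕ) + 1 ≤ q from h', h'.le]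
        · simp [hq, h, h2]
        · have h3 : ¬ (t : ℕ) + 1 ≤ q := by have : (q : ℕ) < t := h'; omega
          simp [hx t h', h.not_ge, h2, h'.not_ge, h3]
  have h1 : ¬ n ≤ p := by omega
  have h2 : ¬ n ≤ q := by omega
  simpa [h1, h2] using key

theorem zpow_apply_of_two_cycle {X : Type*} (c : Equiv.Perm X) {x y : X} (hx : c x = y)
    (hy : c y = x) (m : ℤ) :
    ((c ^ m) x = x ∨ (c ^ m) x = y) ∧ ((c ^ m) y = x ∨ (c ^ m) y = y) := by
  have hx' : c⁻¹ x = y := by rw [Equiv.Perm.inv_eq_iff_eq, hy]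
  have hy' : c⁻¹ y = x := by rw [Equiv.Perm.inv_eq_iff_eq, hx]
  induction m using Int.induction_on with
  | zero => simp
  | succ m ih => simpa [_root_.zpow_add_one, hx, hy] using ih.symm
  | pred m ih =>
    simp only [_root_.zpow_sub_one, Equiv.Perm.mul_apply, hx', hy']
    exact ih.symm

theorem sD_last_apply {n : ℕ} (hn : 4 ≤ n) {u : Fin n} (hu : (u : ℕ) = n - 1)
    {i j : Fin (2 * n)}
    (hij : (i : ℕ) = n - 2 ∧ (j : ℕ) = n ∨ (i : ℕ) = n - 1 ∧ (j : ℕ) = n + 1) :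
    sD n hn u i = j ∧ sD n hn u j = i := by
  rw [sD, dif_neg (by simp [hu])]
  simp only [Equiv.Perm.mul_apply, Equiv.swap_apply_def]
  grind

theorem sD_penultimate_apply {n : ℕ} (hn : 4 ≤ n) {u : Fin n} (hu : (u : ℕ) = n - 2)
    {i j : Fin (2 * n)}
    (hij : (i : ℕ) = n - 2 ∧ (j : ℕ) = n - 1 ∨ (i : ℕ) = n ∧ (j : ℕ) = n + 1) :
    sD n hn u i = j ∧ sD n hn u j = i := by
  rw [sD, dif_pos (show (u : ℕ) < n - 1 by omega)]
  simp only [Equiv.Perm.mul_apply, Equiv.swap_apply_def]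
  grind

theorem sD_apply_of_far (n : ℕ) (hn : 4 ≤ n) (u : Fin n) (j : Fin (2 * n))
    (h1 : (u : ℕ) + 1 < j) (h2 : (j : ℕ) + u + 2 < 2 * n) (hu : (u : ℕ) < n - 1) :
    sD n hn u j = j := by
  rw [sD, dif_pos hu]
  simp only [Equiv.Perm.mul_apply, Equiv.swap_apply_def]
  grind

theorem typeD_coxeter_two_cycle_nm1_barnm1
    (n : ℕ) (hn : 4 ≤ n) (w : Fin n ≃ Fin n)
    -- a, b, d are the positions of the letters n, n-1, n-2 in the word (zero-based letters
    -- n-1, n-2, n-3)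
    (a b d : Fin n)
    (ha : w a = ⟨n - 1, by omega⟩) (hb : w b = ⟨n - 2, by omega⟩)
    (hd : w d = ⟨n - 3, by omega⟩)
    -- d lies strictly between a and b
    (hbetween : (a < d ∧ d < b) ∨ (b < d ∧ d < a)) :
    cD n hn w ⟨n - 2, by omega⟩ = ⟨n + 1, by omega⟩ ∧
    cD n hn w ⟨n + 1, by omega⟩ = ⟨n - 2, by omega⟩ ∧
    ∀ (m : ℤ) (k : ℕ), 1 ≤ k → k ≤ n - 2 →
      (⟨n - 2, by omega⟩ : Fin (2 * n)) ∉ (initSeg (2 * n) k).image ⇑(cD n hn w ^ m) ∧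
      (⟨n + 1, by omega⟩ : Fin (2 * n)) ∉ (initSeg (2 * n) k).image ⇑(cD n hn w ^ m) := by
  have ha' : (w a : ℕ) = n - 1 := by rw [ha]
  have hb' : (w b : ℕ) = n - 2 := by rw [hb]
  obtain ⟨l1, l3⟩ := sD_last_apply hn ha' (i := ⟨n - 2, by omega⟩) (j := ⟨n, by omega⟩) (by simp)
  obtain ⟨l2, l4⟩ := sD_last_apply hn ha' (i := ⟨n - 1, by omega⟩) (j := ⟨n + 1, by omega⟩)
    (by simp)
  obtain ⟨p1, p2⟩ := sD_penultimate_apply hn hb' (i := ⟨n - 2, by omega⟩)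
    (j := ⟨n - 1, by omega⟩) (by simp)
  obtain ⟨p3, p4⟩ := sD_penultimate_apply hn hb' (i := ⟨n, by omega⟩) (j := ⟨n + 1, by omega⟩)
    (by simp)
  have small (t : Fin n) (h1 : t ≠ a) (h2 : t ≠ b) : (w t : ℕ) < n - 2 := by
    have h1' := w.injective.ne h1
    have h2' := w.injective.ne h2
    rw [ha, Ne, Fin.ext_iff] at h1'
    rw [hb, Ne, Fin.ext_iff] at h2'
    simp only at h1' h2'
    omega
  have smaller (t : Fin n) (h1 : t ≠ a) (h2 : t ≠ b) (h3 : t ≠ d) : (w t : ℕ) < n - 3 := by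
    have h3' := w.injective.ne h3
    rw [hd, Ne, Fin.ext_iff] at h3'
    have := small t h1 h2
    simp only at h3'
    omega
  have inner (t : Fin n) (h1 : t ≠ a) (h2 : t ≠ b) (j : Fin (2 * n)) (hj : n - 1 ≤ (j : ℕ))
      (hj' : (j : ℕ) ≤ n) : sD n hn (w t) j = j := by
    have := small t h1 h2
    apply sD_apply_of_far <;> omega
  have outer (t : Fin n) (h1 : t ≠ a) (h2 : t ≠ b) (h3 : t ≠ d) (j : Fin (2 * n))
      (hj : n - 2 ≤ (j : ℕ)) (hj' : (j : ℕ) ≤ n + 1) : sD n hn (w t) j = j := by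
    have := smaller t h1 h2 h3
    apply sD_apply_of_far <;> omega
  have hc : cD n hn w ⟨n - 2, by omega⟩ = ⟨n + 1, by omega⟩ ∧
      cD n hn w ⟨n + 1, by omega⟩ = ⟨n - 2, by omega⟩ := by
    rcases hbetween with ⟨h1, h2⟩ | ⟨h1, h2⟩
    · constructor
      · refine prod_map_finRange_apply_of_two_moves _ (h1.trans h2) (fun t ht => ?_) p1
          (fun t ht ht' => ?_) l2 (fun t ht => ?_)
        · apply outer <;> grind
        · apply inner <;> grind
        · apply outer <;> grind
      · refine prod_map_finRange_apply_of_two_moves _ (h1.trans h2) (fun t ht => ?_) p4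
          (fun t ht ht' => ?_) l3 (fun t ht => ?_)
        · apply outer <;> grind
        · apply inner <;> grind
        · apply outer <;> grind
    · constructor
      · refine prod_map_finRange_apply_of_two_moves _ (h1.trans h2) (fun t ht => ?_) l1
          (fun t ht ht' => ?_) p3 (fun t ht => ?_)
        · apply outer <;> grind
        · apply inner <;> grind
        · apply outer <;> grind
      · refine prod_map_finRange_apply_of_two_moves _ (h1.trans h2) (fun t ht => ?_) l4
          (fun t ht ht' => ?_) p2 (fun t ht => ?_)
        · apply outer <;> grind
        · apply inner <;> grind
        · apply outer <;> grind
  refine ⟨hc.1, hc.2, fun m k _ hk => ?_⟩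
  have hz := zpow_apply_of_two_cycle (cD n hn w) hc.1 hc.2 (-m)
  simp only [_root_.zpow_neg, Equiv.Perm.inv_eq_iff_eq] at hz
  simp only [initSeg, Finset.mem_image, Finset.mem_filter, Finset.mem_univ, true_and]
  constructor
  · rintro ⟨j, hj, hje⟩
    rcases hz.1 with h | h <;> have := ((cD n hn w) ^ m).injective (hje.trans h) <;>
      simp only [Fin.ext_iff] at this <;> omega
  · rintro ⟨j, hj, hje⟩
    rcases hz.2 with h | h <;> have := ((cD n hn w) ^ m).injective (hje.trans h) <;>
      simp only [Fin.ext_iff] at this <;> omega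
end
end

section
/- For every k ∈ {1,…,n−1} and every integer m, set I = c^m({1,…,k}) ⊆ Ω∖{0}. Then every vertex-disjoint path family (p_1,…,p_k) from I to I with nonzero weight is non-crossing: for all indices a, b and all times t ∈ {0,…,2n−1}, if p_a(t) < p_b(t) in the linear order on Ω then p_a(t+1) < p_b(t+1). In particular each path ends at the same element of Ω at which it starts. -/
/-!
Type B_n setup. The index set Ω = {1,…,n, 0, \bar n,…,\bar 1} (ordered
1<⋯<n<0<\bar n<⋯<\bar 1) is identified with `Fin (2*n+1)` in a zero-based way:
the element j (1 ≤ j ≤ n) corresponds to `j-1`, the element 0 to `n`, and \bar j to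
`2*n+1-j`. The letter i_t of the word corresponds to `w ⟨t-1, _⟩` (zero-based letters)
for a bijection `w : Fin n ≃ Fin n`.  We work over R = ℝ[t_1,…,t_n].
-/

open scoped Classical
open Matrix

noncomputable section

abbrev RB (n : ℕ) := MvPolynomial (Fin n) ℝ

/-- The matrix `e_i` of type B_n (zero-based `u = i-1`):
for i ≤ n-1, `e_i = E_{i,i+1} + E_{\bar{i+1},\bar i}`; `e_n = √2(E_{n,0} + E_{0,\bar n})`. -/
def eB (n : ℕ) (hn : 2 ≤ n) (u : Fin n) :
    Matrix (Fin (2 * n + 1)) (Fin (2 * n + 1)) (RB n) :=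
  if _h : (u : ℕ) < n - 1 then
    Matrix.single ⟨u, by have := u.isLt; omega⟩ ⟨(u : ℕ) + 1, by have := u.isLt; omega⟩ 1 +
    Matrix.single ⟨2 * n - 1 - (u : ℕ), by omega⟩ ⟨2 * n - (u : ℕ), by omega⟩ 1
  else
    (MvPolynomial.C (Real.sqrt 2) : RB n) •
      (Matrix.single (⟨n - 1, by omega⟩ : Fin (2 * n + 1)) (⟨n, by omega⟩ : Fin (2 * n + 1)) (1 : RB n) +
       Matrix.single (⟨n, by omega⟩ : Fin (2 * n + 1)) (⟨n + 1, by omega⟩ : Fin (2 * n + 1)) (1 : RB n))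

/-- `x_i(r) = Id + r·e_i + (r²/2)·e_i²`. -/
def xB (n : ℕ) (hn : 2 ≤ n) (u : Fin n) (r : RB n) :
    Matrix (Fin (2 * n + 1)) (Fin (2 * n + 1)) (RB n) :=
  1 + r • eB n hn u + (MvPolynomial.C (1 / 2 : ℝ) * r ^ 2) • (eB n hn u * eB n hn u)

/-- `x̄_i(r) = Id + r·f_i + (r²/2)·f_i²` with `f_i = e_iᵀ`. -/
def xbarB (n : ℕ) (hn : 2 ≤ n) (u : Fin n) (r : RB n) :
    Matrix (Fin (2 * n + 1)) (Fin (2 * n + 1)) (RB n) :=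
  1 + r • (eB n hn u)ᵀ + (MvPolynomial.C (1 / 2 : ℝ) * r ^ 2) • ((eB n hn u)ᵀ * (eB n hn u)ᵀ)

/-- The matrix `M^{(t)}` (zero-based step `t`): `x̄_{i_{t+1}}(1)` for `t < n`,
and `x_{i_{2n-t}}(t_{i_{2n-t}})` for `n ≤ t < 2n`. -/
def stepB (n : ℕ) (hn : 2 ≤ n) (w : Fin n ≃ Fin n) (t : Fin (2 * n)) :
    Matrix (Fin (2 * n + 1)) (Fin (2 * n + 1)) (RB n) :=
  if h : (t : ℕ) < n then xbarB n hn (w ⟨t, h⟩) 1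
  else xB n hn (w ⟨2 * n - 1 - (t : ℕ), by have := t.isLt; omega⟩)
    (MvPolynomial.X (w ⟨2 * n - 1 - (t : ℕ), by have := t.isLt; omega⟩))

/-- `M = M^{(1)} ⋯ M^{(2n)}`. -/
def MB (n : ℕ) (hn : 2 ≤ n) (w : Fin n ≃ Fin n) :
    Matrix (Fin (2 * n + 1)) (Fin (2 * n + 1)) (RB n) :=
  ((List.finRange (2 * n)).map (stepB n hn w)).prod

/-- The simple reflection `s_i` of the Weyl group of type B_n acting on Ω
(zero-based `u = i-1`): for i < n, `s_i = (i,i+1)(\bar{i+1},\bar i)`; `s_n = (n,\bar n)`;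
all fix 0. -/
def sB (n : ℕ) (hn : 2 ≤ n) (u : Fin n) : Equiv.Perm (Fin (2 * n + 1)) :=
  if _h : (u : ℕ) < n - 1 then
    Equiv.swap ⟨u, by have := u.isLt; omega⟩ ⟨(u : ℕ) + 1, by have := u.isLt; omega⟩ *
    Equiv.swap ⟨2 * n - 1 - (u : ℕ), by omega⟩ ⟨2 * n - (u : ℕ), by omega⟩
  else
    Equiv.swap ⟨n - 1, by omega⟩ ⟨n + 1, by omega⟩

/-- The Coxeter element `c = s_{i_1} ∘ ⋯ ∘ s_{i_n}`. -/
def cB (n : ℕ) (hn : 2 ≤ n) (w : Fin n ≃ Fin n) : Equiv.Perm (Fin (2 * n + 1)) :=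
  ((List.finRange n).map fun t => sB n hn (w t)).prod

/-- The subset {1,…,k} of Ω (zero-based: the first k indices). -/
def initSegB (N k : ℕ) : Finset (Fin N) := Finset.filter (fun j => (j : ℕ) < k) Finset.univ

/-- The minor of `M` with row set `I` and column set `J` (rows and columns taken in
increasing order). -/
def minorB {N R : Type*} [Fintype N] [LinearOrder N] [CommRing R]
    (M : Matrix N N R) {k : ℕ} (I J : Finset N) (hI : I.card = k) (hJ : J.card = k) : R :=
  (Matrix.of fun a b : Fin k => M (I.orderIsoOfFin hI a) (J.orderIsoOfFin hJ b)).det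

/-- A vertex-disjoint path family from `I` to `J`. -/
def IsPathFamilyB (n k : ℕ) (I J : Finset (Fin (2 * n + 1)))
    (p : Fin k → Fin (2 * n + 1) → Fin (2 * n + 1)) : Prop :=
  (∀ t, Function.Injective fun a => p a t) ∧
  Finset.image (fun a => p a 0) Finset.univ = I ∧
  Finset.image (fun a => p a (Fin.last (2 * n))) Finset.univ = J

/-- The weight of a path family. -/
def weightB (n : ℕ) (hn : 2 ≤ n) (w : Fin n ≃ Fin n) (k : ℕ)
    (p : Fin k → Fin (2 * n + 1) → Fin (2 * n + 1)) : RB n :=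
  ∏ a : Fin k, ∏ t : Fin (2 * n), stepB n hn w t (p a t.castSucc) (p a t.succ)

/-- The support of `x_u(r)`: either `x = y`, or `x → y` is one of the upward moves along the
letter `u`. -/
def UpMove (n u x y : ℕ) : Prop :=
  x = y ∨ (u < n - 1 ∧ (x = u ∧ y = u + 1 ∨ x = 2 * n - 1 - u ∧ y = 2 * n - u)) ∨
    (u = n - 1 ∧ (x = n - 1 ∧ y = n ∨ x = n ∧ y = n + 1 ∨ x = n - 1 ∧ y = n + 1))

theorem eB_apply_ne_zero {n : ℕ} {hn : 2 ≤ n} {u : Fin n} {x y : Fin (2 * n + 1)}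
    (h : eB n hn u x y ≠ 0) :
    ((u : ℕ) < n - 1 ∧ ((x : ℕ) = u ∧ (y : ℕ) = u + 1 ∨
      (x : ℕ) = 2 * n - 1 - u ∧ (y : ℕ) = 2 * n - u)) ∨
    ((u : ℕ) = n - 1 ∧ ((x : ℕ) = n - 1 ∧ (y : ℕ) = n ∨ (x : ℕ) = n ∧ (y : ℕ) = n + 1)) := by
  contrapose! h
  unfold eB
  split_ifs with hu
  · have h1 := h.1 hu
    rw [Matrix.add_apply, Matrix.single_apply_of_ne, Matrix.single_apply_of_ne, add_zero]
    all_goals simp only [Fin.ext_iff]; omega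
  · have h1 := h.2 (by omega)
    rw [Matrix.smul_apply, Matrix.add_apply, Matrix.single_apply_of_ne,
      Matrix.single_apply_of_ne, add_zero, smul_zero]
    all_goals simp only [Fin.ext_iff]; omega

theorem upMove_of_xB_apply_ne_zero {n : ℕ} {hn : 2 ≤ n} {u : Fin n} {r : RB n}
    {x y : Fin (2 * n + 1)} (h : xB n hn u r x y ≠ 0) : UpMove n u x y := by
  by_contra hxy
  apply h
  unfold UpMove at hxy
  have hne : x ≠ y := fun e => hxy (Or.inl (congrArg Fin.val e))
  have he : eB n hn u x y = 0 := by
    by_contra h1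
    have := eB_apply_ne_zero h1
    omega
  have hee : (eB n hn u * eB n hn u) x y = 0 := by
    rw [Matrix.mul_apply]
    refine Finset.sum_eq_zero fun z _ => ?_
    by_contra h1
    have h2 := eB_apply_ne_zero (left_ne_zero_of_mul h1)
    have h3 := eB_apply_ne_zero (right_ne_zero_of_mul h1)
    omega
  simp [xB, Matrix.one_apply_ne hne, he, hee]

theorem xbarB_eq_transpose_xB (n : ℕ) (hn : 2 ≤ n) (u : Fin n) (r : RB n) :
    xbarB n hn u r = (xB n hn u r)ᵀ := by
  simp [xbarB, xB, Matrix.transpose_mul]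

theorem upMove_of_stepB_apply_ne_zero_of_lt {n : ℕ} {hn : 2 ≤ n} {w : Fin n ≃ Fin n}
    {t : Fin (2 * n)} {x y : Fin (2 * n + 1)} (ht : (t : ℕ) < n)
    (h : stepB n hn w t x y ≠ 0) : UpMove n (w ⟨t, ht⟩) y x := by
  rw [stepB, dif_pos ht, xbarB_eq_transpose_xB] at h
  exact upMove_of_xB_apply_ne_zero h

theorem upMove_of_stepB_apply_ne_zero_of_le {n : ℕ} {hn : 2 ≤ n} {w : Fin n ≃ Fin n}
    {t : Fin (2 * n)} {x y : Fin (2 * n + 1)} (ht : n ≤ (t : ℕ))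
    (h : stepB n hn w t x y ≠ 0) :
    UpMove n (w ⟨2 * n - 1 - (t : ℕ), by have := t.isLt; omega⟩) x y := by
  rw [stepB, dif_neg (by omega)] at h
  exact upMove_of_xB_apply_ne_zero h

/-- Away from the letter `n`, the middle element is fixed. -/
theorem UpMove.eq_middle_iff {n u x y : ℕ} (h : UpMove n u x y) (hu : u < n - 1) :
    x = n ↔ y = n := by
  unfold UpMove at h
  omega

/-- Two disjoint upward moves along the same letter cross only when that letter is `n` and one of
them stays at the middle element. -/
theorem UpMove.lt_iff_lt {n u x y x' y' : ℕ} (h : UpMove n u x y) (h' : UpMove n u x' y')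
    (hx : x ≠ x') (hy : y ≠ y') (hm : u = n - 1 → ¬ (x = n ∧ y = n))
    (hm' : u = n - 1 → ¬ (x' = n ∧ y' = n)) : x < x' ↔ y < y' := by
  unfold UpMove at h h'
  omega

theorem letter_lt_of_ne {n : ℕ} (hn : 2 ≤ n) (w : Fin n ≃ Fin n) {s t : Fin n}
    (hs : (w s : ℕ) = n - 1) (hst : s ≠ t) : (w t : ℕ) < n - 1 := by
  have h1 : (w s : ℕ) ≠ w t := fun e => hst (w.injective (Fin.ext e))
  have := (w t).isLt
  omega

section Path

variable {n : ℕ} {hn : 2 ≤ n} {w : Fin n ≃ Fin n} {q : Fin (2 * n + 1) → Fin (2 * n + 1)}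

/-- A path which is at the middle element before the first use of the letter `n` started there. -/
theorem path_zero_eq_middle (hq : ∀ t : Fin (2 * n), stepB n hn w t (q t.castSucc) (q t.succ) ≠ 0)
    {s : Fin n} (hs : (w s : ℕ) = n - 1) (t : ℕ) (hts : t ≤ s)
    (h : (q ⟨t, by omega⟩ : ℕ) = n) : (q 0 : ℕ) = n := by
  induction t with
  | zero => exact h
  | succ t ih =>
    refine ih (by omega) ?_
    have hm := upMove_of_stepB_apply_ne_zero_of_lt (t := ⟨t, by omega⟩)
      (by simp only; omega) (hq ⟨t, by omega⟩)
    exact (hm.eq_middle_iff (letter_lt_of_ne hn w hs (by simp only [ne_eq, Fin.ext_iff]; omega))).1 h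

/-- A path which is at the middle element after the second use of the letter `n` ends there. -/
theorem path_last_eq_middle (hq : ∀ t : Fin (2 * n), stepB n hn w t (q t.castSucc) (q t.succ) ≠ 0)
    {s : Fin n} (hs : (w s : ℕ) = n - 1) (j : ℕ) (hjs : j ≤ s)
    (h : (q ⟨2 * n - j, by omega⟩ : ℕ) = n) : (q (Fin.last (2 * n)) : ℕ) = n := by
  induction j with
  | zero => exact h
  | succ j ih =>
    refine ih (by omega) ?_
    have hm := upMove_of_stepB_apply_ne_zero_of_le (t := ⟨2 * n - (j + 1), by omega⟩)
      (by simp only; omega) (hq ⟨2 * n - (j + 1), by omega⟩)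
    have key := (hm.eq_middle_iff
      (letter_lt_of_ne hn w hs (by simp only [ne_eq, Fin.ext_iff]; omega))).1 h
    convert key using 4
    simp only [Fin.succ_mk]
    omega

end Path

/-- Disjoint paths that avoid the middle element at both ends do not cross. -/
theorem path_lt_iff_lt {n : ℕ} {hn : 2 ≤ n} {w : Fin n ≃ Fin n}
    {q q' : Fin (2 * n + 1) → Fin (2 * n + 1)}
    (hq : ∀ t : Fin (2 * n), stepB n hn w t (q t.castSucc) (q t.succ) ≠ 0)
    (hq' : ∀ t : Fin (2 * n), stepB n hn w t (q' t.castSucc) (q' t.succ) ≠ 0)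
    (hdisj : ∀ t, q t ≠ q' t)
    (h0 : (q 0 : ℕ) ≠ n) (h0' : (q' 0 : ℕ) ≠ n)
    (hl : (q (Fin.last (2 * n)) : ℕ) ≠ n) (hl' : (q' (Fin.last (2 * n)) : ℕ) ≠ n)
    (t : Fin (2 * n)) : q t.castSucc < q' t.castSucc ↔ q t.succ < q' t.succ := by
  have hd := fun t => Fin.val_ne_of_ne (hdisj t)
  simp only [Fin.lt_def]
  by_cases ht : (t : ℕ) < n
  · refine ((upMove_of_stepB_apply_ne_zero_of_lt ht (hq t)).lt_iff_lt
      (upMove_of_stepB_apply_ne_zero_of_lt ht (hq' t)) (hd _) (hd _) ?_ ?_).symm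
    · exact fun hs h => h0 (path_zero_eq_middle hq hs t le_rfl h.2)
    · exact fun hs h => h0' (path_zero_eq_middle hq' hs t le_rfl h.2)
  · push Not at ht
    have ht' := t.isLt
    have hidx : (⟨2 * n - (2 * n - 1 - (t : ℕ)), by omega⟩ : Fin (2 * n + 1)) = t.succ := by
      simp only [Fin.ext_iff, Fin.val_succ]
      omega
    refine (upMove_of_stepB_apply_ne_zero_of_le ht (hq t)).lt_iff_lt
      (upMove_of_stepB_apply_ne_zero_of_le ht (hq' t)) (hd _) (hd _) ?_ ?_
    · exact fun hs h => hl (path_last_eq_middle hq hs _ le_rfl (by rw [hidx]; exact h.2))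
    · exact fun hs h => hl' (path_last_eq_middle hq' hs _ le_rfl (by rw [hidx]; exact h.2))

theorem sB_apply_middle {n : ℕ} (hn : 2 ≤ n) (u : Fin n) :
    sB n hn u ⟨n, by omega⟩ = ⟨n, by omega⟩ := by
  unfold sB
  split_ifs with hu
  · rw [Equiv.Perm.mul_apply, Equiv.swap_apply_of_ne_of_ne, Equiv.swap_apply_of_ne_of_ne]
    all_goals first
      | (simp only [ne_eq, Fin.ext_iff]; omega)
      | (rw [Equiv.swap_apply_of_ne_of_ne] <;> simp only [ne_eq, Fin.ext_iff] <;> omega)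
  · rw [Equiv.swap_apply_of_ne_of_ne] <;> simp only [ne_eq, Fin.ext_iff] <;> omega

theorem cB_zpow_apply_middle {n : ℕ} (hn : 2 ≤ n) (w : Fin n ≃ Fin n) (m : ℤ) :
    (cB n hn w ^ m) ⟨n, by omega⟩ = ⟨n, by omega⟩ := by
  have hc : cB n hn w ∈ MulAction.stabilizer (Equiv.Perm (Fin (2 * n + 1)))
      (⟨n, by omega⟩ : Fin (2 * n + 1)) := by
    refine Subgroup.list_prod_mem _ fun g hg => ?_
    obtain ⟨t, -, rfl⟩ := List.mem_map.1 hg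
    exact sB_apply_middle hn _
  exact Subgroup.zpow_mem _ hc m

theorem middle_notMem_cB_zpow_image {n k : ℕ} (hn : 2 ≤ n) (w : Fin n ≃ Fin n) (hk : k ≤ n)
    (m : ℤ) : (⟨n, by omega⟩ : Fin (2 * n + 1)) ∉
      (initSegB (2 * n + 1) k).image ⇑(cB n hn w ^ m) := by
  intro h
  obtain ⟨j, hj, hjn⟩ := Finset.mem_image.1 h
  rw [(cB n hn w ^ m).injective (hjn.trans (cB_zpow_apply_middle hn w m).symm)] at hj
  simp only [initSegB, Finset.mem_filter] at hj
  omega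

/-- Two injective tuples with the same image and the same relative order agree. -/
theorem eq_of_lt_imp_lt_of_range_eq {α : Type*} [LinearOrder α] {k : ℕ} {f g : Fin k → α}
    (hf : Function.Injective f) (hfg : ∀ a b, f a < f b → g a < g b)
    (hr : Set.range f = Set.range g) : f = g := by
  have hsf : StrictMono (f ∘ Tuple.sort f) :=
    (Tuple.monotone_sort f).strictMono_of_injective (hf.comp (Tuple.sort f).injective)
  have hsg : StrictMono (g ∘ Tuple.sort f) := fun a b hab => hfg _ _ (hsf hab)
  have h := (hsf.range_inj hsg).1 (by simpa [EquivLike.range_comp] using hr)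
  exact (Tuple.sort f).surjective.injective_comp_right h

theorem typeB_path_families_noncrossing
    (n : ℕ) (hn : 2 ≤ n) (w : Fin n ≃ Fin n)
    (k : ℕ) (hk1 : 1 ≤ k) (hk2 : k ≤ n - 1) (m : ℤ)
    (I : Finset (Fin (2 * n + 1)))
    (hIdef : I = (initSegB (2 * n + 1) k).image ⇑(cB n hn w ^ m))
    (p : Fin k → Fin (2 * n + 1) → Fin (2 * n + 1))
    (hp : IsPathFamilyB n k I I p)
    (hw : weightB n hn w k p ≠ 0) :
    (∀ a b : Fin k, ∀ t : Fin (2 * n),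
        p a t.castSucc < p b t.castSucc → p a t.succ < p b t.succ) ∧
    (∀ a : Fin k, p a (Fin.last (2 * n)) = p a 0) := by
  obtain ⟨hinj, h0, hlast⟩ := hp
  have hstep : ∀ a t, stepB n hn w t (p a t.castSucc) (p a t.succ) ≠ 0 := fun a t =>
    Finset.prod_ne_zero_iff.1 (Finset.prod_ne_zero_iff.1 hw a (Finset.mem_univ _)) t
      (Finset.mem_univ _)
  have hI : ∀ x ∈ I, (x : ℕ) ≠ n := by
    intro x hx hxn
    rw [show x = ⟨n, by omega⟩ from Fin.ext hxn] at hx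
    exact middle_notMem_cB_zpow_image hn w (by omega) m (hIdef ▸ hx)
  have hstart : ∀ a, (p a 0 : ℕ) ≠ n := fun a =>
    hI _ (h0 ▸ Finset.mem_image_of_mem (fun a => p a 0) (Finset.mem_univ a))
  have hend : ∀ a, (p a (Fin.last (2 * n)) : ℕ) ≠ n := fun a =>
    hI _ (hlast ▸ Finset.mem_image_of_mem (fun a => p a (Fin.last (2 * n))) (Finset.mem_univ a))
  have hnc : ∀ a b : Fin k, ∀ t : Fin (2 * n),
      p a t.castSucc < p b t.castSucc → p a t.succ < p b t.succ := by
    intro a b t hab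
    have hne : a ≠ b := by rintro rfl; exact lt_irrefl _ hab
    exact (path_lt_iff_lt (hstep a) (hstep b) (fun s => (hinj s).ne hne) (hstart a) (hstart b)
      (hend a) (hend b) t).1 hab
  refine ⟨hnc, fun a => ?_⟩
  have hall : ∀ a b : Fin k, p a 0 < p b 0 → ∀ t, p a t < p b t := fun a b hab t =>
    Fin.induction hab (fun t ht => hnc a b t ht) t
  have hr : Set.range (fun a => p a 0) = Set.range (fun a => p a (Fin.last (2 * n))) := by
    have := congrArg (fun s : Finset (Fin (2 * n + 1)) => (s : Set (Fin (2 * n + 1))))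
      (h0.trans hlast.symm)
    simpa using this
  exact (congrFun (eq_of_lt_imp_lt_of_range_eq (hinj 0) (fun a b hab => hall a b hab _) hr) a).symm
end
end

section
/- For every k ∈ {1,…,n−1} and every integer m, every coefficient of the polynomial Δ_{I,I}(M) ∈ ℝ[t_1,…,t_n], where I = c^m({1,…,k}), is nonnegative. (This polynomial is the F-polynomial F_{c^m ω_k} in type B_n; in particular these F-polynomials have positive coefficients.) -/
/-!
Type B_n setup. The index set Ω = {1,…,n, 0, \bar n,…,\bar 1} (ordered
1<⋯<n<0<\bar n<⋯<\bar 1) is identified with `Fin (2*n+1)` in a zero-based way: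
the element j (1 ≤ j ≤ n) corresponds to `j-1`, the element 0 to `n`, and \bar j to
`2*n+1-j`. The letter i_t of the word corresponds to `w ⟨t-1, _⟩` (zero-based letters)
for a bijection `w : Fin n ≃ Fin n`.  We work over R = ℝ[t_1,…,t_n].
-/

open scoped Classical
open Matrix

noncomputable section

/-- All coefficients of the polynomial are nonnegative. -/
def NonnegCoeffs {σ : Type*} (p : MvPolynomial σ ℝ) : Prop := ∀ d, 0 ≤ p.coeff d

namespace NonnegCoeffs

variable {σ : Type*} {p q : MvPolynomial σ ℝ}

lemma add (hp : NonnegCoeffs p) (hq : NonnegCoeffs q) : NonnegCoeffs (p + q) := fun d => by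
  rw [MvPolynomial.coeff_add]
  exact add_nonneg (hp d) (hq d)

lemma mul (hp : NonnegCoeffs p) (hq : NonnegCoeffs q) : NonnegCoeffs (p * q) := fun d => by
  rw [MvPolynomial.coeff_mul]
  exact Finset.sum_nonneg fun x _ => mul_nonneg (hp x.1) (hq x.2)

lemma C {a : ℝ} (ha : 0 ≤ a) : NonnegCoeffs (MvPolynomial.C a : MvPolynomial σ ℝ) := fun d => by
  rw [MvPolynomial.coeff_C]
  split_ifs <;> simp [ha]

lemma zero : NonnegCoeffs (0 : MvPolynomial σ ℝ) := fun d => by simp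

lemma one : NonnegCoeffs (1 : MvPolynomial σ ℝ) := by
  simpa using C (σ := σ) zero_le_one

lemma X (i : σ) : NonnegCoeffs (MvPolynomial.X i : MvPolynomial σ ℝ) := fun d => by
  rw [MvPolynomial.coeff_X]
  split_ifs <;> simp

end NonnegCoeffs

/-- Every minor of the polynomial matrix `M` has nonnegative coefficients. -/
def CoeffwiseTotallyNonneg {σ : Type*} {m N : ℕ}
    (M : Matrix (Fin m) (Fin N) (MvPolynomial σ ℝ)) : Prop :=
  ∀ (k : ℕ) (f : Fin k → Fin m) (g : Fin k → Fin N), StrictMono f → StrictMono g →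
    NonnegCoeffs (M.submatrix f g).det

lemma strictMono_eq_of_range_subset {k N : ℕ} {f g : Fin k → Fin N} (hf : StrictMono f)
    (hg : StrictMono g) (h : Set.range f ⊆ Set.range g) : f = g := by
  refine (hf.range_inj hg).1 (Set.eq_of_subset_of_ncard_le h ?_ (Set.toFinite _))
  rw [← Set.image_univ, ← Set.image_univ, Set.ncard_image_of_injective _ hf.injective,
    Set.ncard_image_of_injective _ hg.injective]

lemma coeffwiseTotallyNonneg_one {σ : Type*} {N : ℕ} :
    CoeffwiseTotallyNonneg (1 : Matrix (Fin N) (Fin N) (MvPolynomial σ ℝ)) := by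
  intro k f g hf hg
  by_cases h : Set.range f ⊆ Set.range g
  · rw [strictMono_eq_of_range_subset hf hg h, Matrix.submatrix_one g hg.injective, Matrix.det_one]
    exact NonnegCoeffs.one
  · obtain ⟨_, ⟨a, rfl⟩, ha⟩ := Set.not_subset.1 h
    rw [Matrix.det_eq_zero_of_row_eq_zero a fun b =>
      Matrix.one_apply_ne (i := f a) (j := g b) fun hab => ha ⟨b, hab.symm⟩]
    exact NonnegCoeffs.zero

/-- Replacing a value of a strictly increasing sequence by an adjacent one that is not
attained keeps it strictly increasing. -/
lemma StrictMono.update_adjacent {k N : ℕ} {g : Fin k → Fin N} (hg : StrictMono g) {b : Fin k}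
    {i : Fin N} (hi : ∀ c, g c ≠ i)
    (hadj : (i : ℕ) + 1 = g b ∨ (g b : ℕ) + 1 = i) :
    StrictMono (Function.update g b i) := by
  intro x y hxy
  have hxy' := hg hxy
  have hx := hi x
  have hy := hi y
  simp only [Function.update_apply]
  split_ifs with h₁ h₂ h₂
  · exact absurd (h₁.trans h₂.symm) hxy.ne
  all_goals
    try subst h₁
    try subst h₂
    simp only [ne_eq, Fin.ext_iff, Fin.lt_def] at *
    omega

lemma CoeffwiseTotallyNonneg.mul_elementary {σ : Type*} {m N : ℕ}
    {M : Matrix (Fin m) (Fin N) (MvPolynomial σ ℝ)}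
    (hM : CoeffwiseTotallyNonneg M) {i j : Fin N}
    (hadj : (i : ℕ) + 1 = j ∨ (j : ℕ) + 1 = i) {a : MvPolynomial σ ℝ} (ha : NonnegCoeffs a) :
    CoeffwiseTotallyNonneg (M * (1 + a • Matrix.single i j (1 : MvPolynomial σ ℝ))) := by
  intro k f g hf hg
  have hentry : ∀ x y, (M * (1 + a • Matrix.single i j (1 : MvPolynomial σ ℝ)) :
      Matrix (Fin m) (Fin N) (MvPolynomial σ ℝ)) x y =
      M x y + if y = j then a * M x i else 0 := by
    intro x y
    rw [Matrix.mul_add, Matrix.mul_one, Matrix.mul_smul, Matrix.add_apply, Matrix.smul_apply]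
    split_ifs with h
    · subst h
      simp
    · rw [Matrix.mul_single_apply_of_ne _ _ _ _ _ h, smul_zero]
  by_cases hj : ∃ b, g b = j
  · obtain ⟨b, hb⟩ := hj
    have hsub : (M * (1 + a • Matrix.single i j (1 : MvPolynomial σ ℝ))).submatrix f g =
        (M.submatrix f g).updateCol b
          ((fun x => M (f x) (g b)) + a • fun x => M (f x) i) := by
      ext1 x y
      rw [Matrix.submatrix_apply, hentry, Matrix.updateCol_apply]
      by_cases hy : y = b
      · simp [hy, hb]
      · have : g y ≠ j := fun h => hy (hg.injective (h.trans hb.symm))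
        simp [hy, this]
    have hfst : (M.submatrix f g).updateCol b (fun x => M (f x) (g b)) = M.submatrix f g :=
      Matrix.updateCol_eq_self _ _
    have hsnd : (M.submatrix f g).updateCol b (fun x => M (f x) i) =
        M.submatrix f (Function.update g b i) := by
      ext1 x y
      rw [Matrix.updateCol_apply, Matrix.submatrix_apply, Matrix.submatrix_apply,
        Function.update_apply]
      split_ifs <;> rfl
    rw [hsub, Matrix.det_updateCol_add, Matrix.det_updateCol_smul, hfst, hsnd]
    refine (hM k f g hf hg).add (ha.mul ?_)
    by_cases hi : ∃ c, g c = i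
    · obtain ⟨c, hc⟩ := hi
      have hcb : c ≠ b := by
        rintro rfl
        rw [← hc, ← hb] at hadj
        omega
      rw [Matrix.det_zero_of_column_eq hcb fun x => by simp [hcb, hc]]
      exact NonnegCoeffs.zero
    · exact hM k f _ hf (hg.update_adjacent (fun c hc => hi ⟨c, hc⟩) (by rwa [hb]))
  · have : (M * (1 + a • Matrix.single i j (1 : MvPolynomial σ ℝ))).submatrix f g = M.submatrix f g := by
      ext1 x y
      rw [Matrix.submatrix_apply, hentry, if_neg fun h => hj ⟨y, h⟩, add_zero,
        Matrix.submatrix_apply]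
    rw [this]
    exact hM k f g hf hg

lemma xB_of_lt {n : ℕ} (hn : 2 ≤ n) (u : Fin n) (r : RB n) (h : (u : ℕ) < n - 1) :
    xB n hn u r =
      (1 + r • Matrix.single ⟨u, by omega⟩ ⟨(u : ℕ) + 1, by omega⟩ 1) *
      (1 + r • Matrix.single ⟨2 * n - 1 - (u : ℕ), by omega⟩ ⟨2 * n - (u : ℕ), by omega⟩ 1) := by
  have hu := u.isLt
  rw [xB, eB, dif_pos h]
  simp only [mul_add, add_mul, Matrix.mul_smul, Matrix.smul_mul, mul_one, one_mul, smul_add]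
  rw [Matrix.single_mul_single_of_ne, Matrix.single_mul_single_of_ne,
    Matrix.single_mul_single_of_ne, Matrix.single_mul_single_of_ne]
  · simp only [smul_zero]
    abel
  all_goals
    rw [ne_eq, Fin.mk.injEq]
    omega

lemma xB_of_not_lt {n : ℕ} (hn : 2 ≤ n) (u : Fin n) (r : RB n) (h : ¬ (u : ℕ) < n - 1) :
    xB n hn u r =
      (1 + (MvPolynomial.C (√2 / 2) * r) • Matrix.single ⟨n - 1, by omega⟩ ⟨n, by omega⟩ 1) *
      (1 + (MvPolynomial.C √2 * r) • Matrix.single ⟨n, by omega⟩ ⟨n + 1, by omega⟩ 1) *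
      (1 + (MvPolynomial.C (√2 / 2) * r) • Matrix.single ⟨n - 1, by omega⟩ ⟨n, by omega⟩ 1) := by
  rw [xB, eB, dif_neg h]
  set A : Matrix (Fin (2 * n + 1)) (Fin (2 * n + 1)) (RB n) :=
    Matrix.single ⟨n - 1, by omega⟩ ⟨n, by omega⟩ 1 with hA
  set B : Matrix (Fin (2 * n + 1)) (Fin (2 * n + 1)) (RB n) :=
    Matrix.single ⟨n, by omega⟩ ⟨n + 1, by omega⟩ 1 with hB
  have hAA : A * A = 0 :=
    Matrix.single_mul_single_of_ne _ _ _ _ (by rw [ne_eq, Fin.mk.injEq]; omega) _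
  have hBB : B * B = 0 :=
    Matrix.single_mul_single_of_ne _ _ _ _ (by rw [ne_eq, Fin.mk.injEq]; omega) _
  have hBA : B * A = 0 :=
    Matrix.single_mul_single_of_ne _ _ _ _ (by rw [ne_eq, Fin.mk.injEq]; omega) _
  have hhalf : (MvPolynomial.C √2 : RB n) = MvPolynomial.C (√2 / 2) + MvPolynomial.C (√2 / 2) := by
    rw [← map_add, add_halves]
  have hprod : (MvPolynomial.C (√2 / 2) * MvPolynomial.C √2 : RB n) = 1 := by
    rw [← map_mul, div_mul_eq_mul_div, Real.mul_self_sqrt (by norm_num), div_self (by norm_num),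
      map_one]
  have hsq : (MvPolynomial.C (1 / 2) * (MvPolynomial.C √2 * MvPolynomial.C √2) : RB n) = 1 := by
    rw [← map_mul, ← map_mul, Real.mul_self_sqrt (by norm_num), one_div_mul_cancel (by norm_num),
      map_one]
  simp only [mul_add, add_mul, Matrix.mul_smul, Matrix.smul_mul, mul_one, one_mul, smul_add,
    mul_assoc, hAA, hBA, hBB, smul_zero, mul_zero, add_zero, zero_add]
  match_scalars
  · ring
  · linear_combination r * hhalf
  · ring
  · linear_combination r ^ 2 * (hsq - hprod)

lemma xbarB_eq_transpose {n : ℕ} (hn : 2 ≤ n) (u : Fin n) (r : RB n) :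
    xbarB n hn u r = (xB n hn u r)ᵀ := by
  simp [xbarB, xB, Matrix.transpose_mul]

namespace CoeffwiseTotallyNonneg

variable {n m : ℕ} {M : Matrix (Fin m) (Fin (2 * n + 1)) (RB n)}

lemma mul_xB (hM : CoeffwiseTotallyNonneg M) (hn : 2 ≤ n) (u : Fin n) {r : RB n}
    (hr : NonnegCoeffs r) : CoeffwiseTotallyNonneg (M * xB n hn u r) := by
  have hu := u.isLt
  by_cases h : (u : ℕ) < n - 1
  · rw [xB_of_lt hn u r h, ← Matrix.mul_assoc]
    refine (hM.mul_elementary ?_ hr).mul_elementary ?_ hr <;> simp only [true_or] <;> omega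
  · have hr' := (NonnegCoeffs.C (σ := Fin n) (a := √2 / 2) (by positivity)).mul hr
    have hr'' := (NonnegCoeffs.C (σ := Fin n) (a := √2) (by positivity)).mul hr
    rw [xB_of_not_lt hn u r h, ← Matrix.mul_assoc, ← Matrix.mul_assoc]
    refine ((hM.mul_elementary ?_ hr').mul_elementary ?_ hr'').mul_elementary ?_ hr' <;>
      simp only [true_or] <;> omega

lemma mul_xbarB (hM : CoeffwiseTotallyNonneg M) (hn : 2 ≤ n) (u : Fin n) {r : RB n}
    (hr : NonnegCoeffs r) : CoeffwiseTotallyNonneg (M * xbarB n hn u r) := by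
  have hu := u.isLt
  rw [xbarB_eq_transpose]
  by_cases h : (u : ℕ) < n - 1
  · rw [xB_of_lt hn u r h]
    simp only [Matrix.transpose_mul, Matrix.transpose_add, Matrix.transpose_smul,
      Matrix.transpose_one, Matrix.transpose_single]
    rw [← Matrix.mul_assoc]
    refine (hM.mul_elementary ?_ hr).mul_elementary ?_ hr <;> simp only [or_true] <;> omega
  · have hr' := (NonnegCoeffs.C (σ := Fin n) (a := √2 / 2) (by positivity)).mul hr
    have hr'' := (NonnegCoeffs.C (σ := Fin n) (a := √2) (by positivity)).mul hr
    rw [xB_of_not_lt hn u r h]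
    simp only [Matrix.transpose_mul, Matrix.transpose_add, Matrix.transpose_smul,
      Matrix.transpose_one, Matrix.transpose_single]
    rw [← Matrix.mul_assoc, ← Matrix.mul_assoc]
    refine ((hM.mul_elementary ?_ hr').mul_elementary ?_ hr'').mul_elementary ?_ hr' <;>
      simp only [or_true] <;> omega

lemma mul_stepB (hM : CoeffwiseTotallyNonneg M) (hn : 2 ≤ n) (w : Fin n ≃ Fin n)
    (t : Fin (2 * n)) : CoeffwiseTotallyNonneg (M * stepB n hn w t) := by
  rw [stepB]
  split_ifs
  · exact hM.mul_xbarB hn _ NonnegCoeffs.one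
  · exact hM.mul_xB hn _ (NonnegCoeffs.X _)

lemma mul_prod_stepB (hM : CoeffwiseTotallyNonneg M) (hn : 2 ≤ n) (w : Fin n ≃ Fin n)
    (l : List (Fin (2 * n))) : CoeffwiseTotallyNonneg (M * (l.map (stepB n hn w)).prod) := by
  induction l generalizing M with
  | nil => simpa using hM
  | cons t l ih =>
    rw [List.map_cons, List.prod_cons, ← Matrix.mul_assoc]
    exact ih (hM.mul_stepB hn w t)

end CoeffwiseTotallyNonneg

lemma coeffwiseTotallyNonneg_MB {n : ℕ} (hn : 2 ≤ n) (w : Fin n ≃ Fin n) :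
    CoeffwiseTotallyNonneg (MB n hn w) := by
  simpa [MB] using coeffwiseTotallyNonneg_one.mul_prod_stepB hn w (List.finRange (2 * n))

theorem typeB_Fpolynomial_coefficients_nonneg
    (n : ℕ) (hn : 2 ≤ n) (w : Fin n ≃ Fin n)
    (k : ℕ) (hk1 : 1 ≤ k) (hk2 : k ≤ n - 1) (m : ℤ)
    (I : Finset (Fin (2 * n + 1)))
    (hIdef : I = (initSegB (2 * n + 1) k).image ⇑(cB n hn w ^ m))
    (hI : I.card = k) (d : Fin n →₀ ℕ) :
    0 ≤ MvPolynomial.coeff d (minorB (MB n hn w) I I hI hI) := by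
  exact coeffwiseTotallyNonneg_MB hn w k _ _
    (fun _ _ h => (I.orderIsoOfFin hI).strictMono h)
    (fun _ _ h => (I.orderIsoOfFin hI).strictMono h) d
end
end

section
/- For any k and any k-subsets I, J of Ω, every vertex-disjoint path family (p_1,…,p_k) from I to J with nonzero weight is non-crossing: for all indices a, b and all times t ∈ {0,…,2n−1}, if p_a(t) < p_b(t) in the linear order on Ω then p_a(t+1) < p_b(t+1). In particular the family connects the r-th smallest element of I to the r-th smallest element of J for each r. -/
/-!
Type C_n setup. The index set Ω = {1,…,n, \bar n,…,\bar 1} (ordered 1<⋯<n<\bar n<⋯<\bar 1)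
is identified with `Fin (2*n)` in a zero-based way: j corresponds to `j-1` and \bar j to
`2*n-j`. The letter i_t of the word corresponds to `w ⟨t-1, _⟩` (zero-based letters) for a
bijection `w : Fin n ≃ Fin n`.  We work over R = ℤ[t_1,…,t_n].
-/

open scoped Classical
open Matrix

noncomputable section

abbrev RC (n : ℕ) := MvPolynomial (Fin n) ℤ

/-- The matrix `e_i` of type C_n (zero-based `u = i-1`):
for i ≤ n-1, `e_i = E_{i,i+1} + E_{\bar{i+1},\bar i}`; `e_n = E_{n,\bar n}`. -/
def eC (n : ℕ) (hn : 2 ≤ n) (u : Fin n) : Matrix (Fin (2 * n)) (Fin (2 * n)) (RC n) :=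
  if _h : (u : ℕ) < n - 1 then
    Matrix.single ⟨u, by have := u.isLt; omega⟩ ⟨(u : ℕ) + 1, by have := u.isLt; omega⟩ 1 +
    Matrix.single ⟨2 * n - 2 - (u : ℕ), by omega⟩ ⟨2 * n - 1 - (u : ℕ), by omega⟩ 1
  else
    Matrix.single ⟨n - 1, by omega⟩ ⟨n, by omega⟩ 1

/-- The matrix `M^{(t)}` (zero-based step `t`): `x̄_{i_{t+1}}(1) = Id + f_{i_{t+1}}` for
`t < n` (where `f_i = e_iᵀ`), and `x_{i_{2n-t}}(t_{i_{2n-t}}) = Id + t_{i_{2n-t}}·e_{i_{2n-t}}`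
for `n ≤ t < 2n`. -/
def stepC (n : ℕ) (hn : 2 ≤ n) (w : Fin n ≃ Fin n) (t : Fin (2 * n)) :
    Matrix (Fin (2 * n)) (Fin (2 * n)) (RC n) :=
  if h : (t : ℕ) < n then 1 + (eC n hn (w ⟨t, h⟩))ᵀ
  else 1 + (MvPolynomial.X (w ⟨2 * n - 1 - (t : ℕ), by have := t.isLt; omega⟩) : RC n) •
    eC n hn (w ⟨2 * n - 1 - (t : ℕ), by have := t.isLt; omega⟩)

/-- `M = M^{(1)} ⋯ M^{(2n)}`. -/
def MC (n : ℕ) (hn : 2 ≤ n) (w : Fin n ≃ Fin n) : Matrix (Fin (2 * n)) (Fin (2 * n)) (RC n) :=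
  ((List.finRange (2 * n)).map (stepC n hn w)).prod

/-- The simple reflection `s_i` of the Weyl group of type C_n acting on Ω
(zero-based `u = i-1`): for i < n, `s_i = (i,i+1)(\bar{i+1},\bar i)`; `s_n = (n,\bar n)`. -/
def sC (n : ℕ) (hn : 2 ≤ n) (u : Fin n) : Equiv.Perm (Fin (2 * n)) :=
  if _h : (u : ℕ) < n - 1 then
    Equiv.swap ⟨u, by have := u.isLt; omega⟩ ⟨(u : ℕ) + 1, by have := u.isLt; omega⟩ *
    Equiv.swap ⟨2 * n - 2 - (u : ℕ), by omega⟩ ⟨2 * n - 1 - (u : ℕ), by omega⟩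
  else
    Equiv.swap ⟨n - 1, by omega⟩ ⟨n, by omega⟩

/-- The Coxeter element `c = s_{i_1} ∘ ⋯ ∘ s_{i_n}`. -/
def cC (n : ℕ) (hn : 2 ≤ n) (w : Fin n ≃ Fin n) : Equiv.Perm (Fin (2 * n)) :=
  ((List.finRange n).map fun t => sC n hn (w t)).prod

/-- The subset {1,…,k} of Ω (zero-based: the first k indices). -/
def initSegC (N k : ℕ) : Finset (Fin N) := Finset.filter (fun j => (j : ℕ) < k) Finset.univ

/-- The minor of `M` with row set `I` and column set `J` (rows and columns taken in
increasing order). -/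
def minorC {N R : Type*} [Fintype N] [LinearOrder N] [CommRing R]
    (M : Matrix N N R) {k : ℕ} (I J : Finset N) (hI : I.card = k) (hJ : J.card = k) : R :=
  (Matrix.of fun a b : Fin k => M (I.orderIsoOfFin hI a) (J.orderIsoOfFin hJ b)).det

/-- A vertex-disjoint path family from `I` to `J`. -/
def IsPathFamilyC (n k : ℕ) (I J : Finset (Fin (2 * n)))
    (p : Fin k → Fin (2 * n + 1) → Fin (2 * n)) : Prop :=
  (∀ t, Function.Injective fun a => p a t) ∧
  Finset.image (fun a => p a 0) Finset.univ = I ∧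
  Finset.image (fun a => p a (Fin.last (2 * n))) Finset.univ = J

/-- The weight of a path family. -/
def weightC (n : ℕ) (hn : 2 ≤ n) (w : Fin n ≃ Fin n) (k : ℕ)
    (p : Fin k → Fin (2 * n + 1) → Fin (2 * n)) : RC n :=
  ∏ a : Fin k, ∏ t : Fin (2 * n), stepC n hn w t (p a t.castSucc) (p a t.succ)

theorem eC_apply_ne_zero {n : ℕ} {hn : 2 ≤ n} {u : Fin n} {x y : Fin (2 * n)}
    (h : eC n hn u x y ≠ 0) : (y : ℕ) = x + 1 := by
  contrapose! h
  have hu := u.isLt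
  unfold eC
  split_ifs with hlt
  · rw [Matrix.add_apply, Matrix.single_apply_of_ne, Matrix.single_apply_of_ne, add_zero]
    all_goals
      rintro ⟨rfl, rfl⟩
      simp only at h
      omega
  · apply Matrix.single_apply_of_ne
    rintro ⟨rfl, rfl⟩
    simp only at h
    omega

/-- Within a single step, all nonzero moves go weakly down by at most one, or all go weakly up by
at most one. -/
theorem stepC_apply_ne_zero (n : ℕ) (hn : 2 ≤ n) (w : Fin n ≃ Fin n) (t : Fin (2 * n)) :
    (∀ x y, stepC n hn w t x y ≠ 0 → x = y ∨ (x : ℕ) = y + 1) ∨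
    (∀ x y, stepC n hn w t x y ≠ 0 → x = y ∨ (y : ℕ) = x + 1) := by
  by_cases ht : (t : ℕ) < n
  · refine Or.inl fun x y h => or_iff_not_imp_left.2 fun hxy => ?_
    rw [stepC, dif_pos ht, Matrix.add_apply, Matrix.one_apply_ne hxy, zero_add,
      Matrix.transpose_apply] at h
    exact eC_apply_ne_zero h
  · refine Or.inr fun x y h => or_iff_not_imp_left.2 fun hxy => ?_
    rw [stepC, dif_neg ht, Matrix.add_apply, Matrix.one_apply_ne hxy, zero_add,
      Matrix.smul_apply, smul_eq_mul] at h
    exact eC_apply_ne_zero (right_ne_zero_of_mul h)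

/-- Two vertex-disjoint moves with nonzero weight in the same step preserve the order. -/
theorem stepC_lt_of_lt {n : ℕ} {hn : 2 ≤ n} {w : Fin n ≃ Fin n} {t : Fin (2 * n)}
    {x x' y y' : Fin (2 * n)} (hx : stepC n hn w t x x' ≠ 0) (hy : stepC n hn w t y y' ≠ 0)
    (hlt : x < y) (hne : x' ≠ y') : x' < y' := by
  rcases stepC_apply_ne_zero n hn w t with h | h <;>
    rcases h _ _ hx with h₁ | h₁ <;> rcases h _ _ hy with h₂ | h₂ <;> omega

theorem typeC_path_families_noncrossing
    (n : ℕ) (hn : 2 ≤ n) (w : Fin n ≃ Fin n)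
    (k : ℕ) (I J : Finset (Fin (2 * n))) (hI : I.card = k) (hJ : J.card = k)
    (p : Fin k → Fin (2 * n + 1) → Fin (2 * n))
    (hp : IsPathFamilyC n k I J p)
    (hw : weightC n hn w k p ≠ 0) :
    (∀ a b : Fin k, ∀ t : Fin (2 * n),
        p a t.castSucc < p b t.castSucc → p a t.succ < p b t.succ) ∧
    (∀ r : Fin k, ∃ a : Fin k,
        p a 0 = (I.orderIsoOfFin hI r : Fin (2 * n)) ∧
        p a (Fin.last (2 * n)) = (J.orderIsoOfFin hJ r : Fin (2 * n))) := by
  obtain ⟨hinj, hpI, hpJ⟩ := hp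
  have hne : ∀ a t, stepC n hn w t (p a t.castSucc) (p a t.succ) ≠ 0 := fun a t =>
    Finset.prod_ne_zero_iff.1 (Finset.prod_ne_zero_iff.1 hw a (Finset.mem_univ _)) t
      (Finset.mem_univ _)
  have hstep : ∀ a b : Fin k, ∀ t : Fin (2 * n),
      p a t.castSucc < p b t.castSucc → p a t.succ < p b t.succ := fun a b t hlt =>
    stepC_lt_of_lt (hne a t) (hne b t) hlt fun heq =>
      hlt.ne (congrArg (fun c => p c t.castSucc) (hinj t.succ heq))
  refine ⟨hstep, ?_⟩
  have hmono : ∀ a b : Fin k, p a 0 < p b 0 → ∀ t, p a t < p b t := fun a b h0 t =>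
    Fin.induction h0 (fun t => hstep a b t) t
  have hsource : ∀ r : Fin k, ∃ a, p a 0 = (I.orderIsoOfFin hI r : Fin (2 * n)) := fun r => by
    obtain ⟨a, -, ha⟩ := Finset.mem_image.1 (hpI.ge (I.orderIsoOfFin hI r).2)
    exact ⟨a, ha⟩
  choose σ hσ using hsource
  have htarget : (fun r => p (σ r) (Fin.last (2 * n))) = J.orderEmbOfFin hJ := by
    refine Finset.orderEmbOfFin_unique hJ (fun r => ?_) fun r s hrs => hmono _ _ ?_ _
    · rw [← hpJ]
      exact Finset.mem_image_of_mem _ (Finset.mem_univ _)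
    · rw [hσ, hσ]
      exact (I.orderIsoOfFin hI).strictMono hrs
  exact fun r => ⟨σ r, hσ r, congrFun htarget r⟩
end
end

section
/- For every k ∈ {1,…,n} and every integer m, every coefficient of the polynomial Δ_{I,I}(M) ∈ ℤ[t_1,…,t_n], where I = c^m({1,…,k}), is a nonnegative integer. (This polynomial is the F-polynomial F_{c^m ω_k} in type C_n; in particular these F-polynomials have positive coefficients.) -/
/-!
Type C_n setup. The index set Ω = {1,…,n, \bar n,…,\bar 1} (ordered 1<⋯<n<\bar n<⋯<\bar 1)
is identified with `Fin (2*n)` in a zero-based way: j corresponds to `j-1` and \bar j to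
`2*n-j`. The letter i_t of the word corresponds to `w ⟨t-1, _⟩` (zero-based letters) for a
bijection `w : Fin n ≃ Fin n`.  We work over R = ℤ[t_1,…,t_n].
-/

open scoped Classical
open Matrix

noncomputable section

/-- A matrix is totally nonnegative relative to a subsemiring `S` of nonnegative elements if all
its minors lie in `S`. -/
def Matrix.IsTotallyNonneg {N : ℕ} {R : Type*} [CommRing R] (S : Subsemiring R)
    (A : Matrix (Fin N) (Fin N) R) : Prop :=
  ∀ (k : ℕ) (f g : Fin k → Fin N), StrictMono f → StrictMono g → (A.submatrix f g).det ∈ S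

section TotallyNonneg

variable {N : ℕ} {R : Type*} [CommRing R] {S : Subsemiring R}

theorem Matrix.isTotallyNonneg_one :
    (1 : Matrix (Fin N) (Fin N) R).IsTotallyNonneg S := by
  intro k f g hf hg
  by_cases h : Set.range f ⊆ Set.range g
  · have hfg : f = g := by
      refine (hf.range_inj hg).1 (Set.eq_of_subset_of_ncard_le h ?_ (Set.finite_range g))
      rw [Set.ncard_range_of_injective hf.injective, Set.ncard_range_of_injective hg.injective]
    subst hfg
    rw [Matrix.submatrix_one f hf.injective, Matrix.det_one]
    exact S.one_mem
  · obtain ⟨_, ⟨a, rfl⟩, ha⟩ := Set.not_subset.1 h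
    have hrow : ∀ b, (1 : Matrix (Fin N) (Fin N) R).submatrix f g a b = 0 := fun b => by
      rw [Matrix.submatrix_apply]
      exact Matrix.one_apply_ne fun hab => ha ⟨b, hab.symm⟩
    rw [Matrix.det_eq_zero_of_row_eq_zero a hrow]
    exact S.zero_mem

/-- Replacing a value of a strictly monotone map by an adjacent value that is not attained
preserves strict monotonicity. -/
theorem StrictMono.update_of_adjacent {k : ℕ} {g : Fin k → Fin N} (hg : StrictMono g) {b : Fin k}
    {i : Fin N} (hi : i ∉ Set.range g) (hij : (i : ℕ) = g b + 1 ∨ (g b : ℕ) = i + 1) :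
    StrictMono (Function.update g b i) := by
  intro x y hxy
  have hne : ∀ z, (g z : ℕ) ≠ i := fun z hz => hi ⟨z, Fin.ext hz⟩
  by_cases hx : x = b
  · subst hx
    rw [Function.update_self, Function.update_of_ne hxy.ne']
    have h1 : (g x : ℕ) < g y := hg hxy
    have h2 := hne y
    rw [Fin.lt_def]
    omega
  · by_cases hy : y = b
    · subst hy
      rw [Function.update_self, Function.update_of_ne hxy.ne]
      have h1 : (g x : ℕ) < g y := hg hxy
      have h2 := hne x
      rw [Fin.lt_def]
      omega
    · rw [Function.update_of_ne hx, Function.update_of_ne hy]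
      exact hg hxy

theorem Matrix.mul_one_add_single_apply (A : Matrix (Fin N) (Fin N) R) (i j : Fin N) (r : R)
    (x y : Fin N) :
    (A * (1 + Matrix.single i j r)) x y = A x y + if y = j then r * A x i else 0 := by
  rw [mul_add, mul_one, Matrix.add_apply]
  split_ifs with h
  · subst h
    rw [Matrix.mul_single_apply_same, mul_comm]
  · rw [Matrix.mul_single_apply_of_ne _ _ _ _ _ h]

theorem Matrix.IsTotallyNonneg.mul_one_add_single {A : Matrix (Fin N) (Fin N) R}
    (hA : A.IsTotallyNonneg S) {i j : Fin N} (hij : (i : ℕ) = j + 1 ∨ (j : ℕ) = i + 1)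
    {r : R} (hr : r ∈ S) :
    (A * (1 + Matrix.single i j r)).IsTotallyNonneg S := by
  intro k f g hf hg
  by_cases hj : j ∈ Set.range g
  · obtain ⟨b, rfl⟩ := hj
    have hcol : (A * (1 + Matrix.single i (g b) r)).submatrix f g =
        (A.submatrix f g).updateCol b
          ((fun x => A (f x) (g b)) + r • fun x => A (f x) i) := by
      ext x y
      rw [Matrix.submatrix_apply, Matrix.mul_one_add_single_apply, Matrix.updateCol_apply]
      by_cases hy : y = b
      · subst hy; simp
      · simp [hy, hg.injective.eq_iff]
    have hself : (A.submatrix f g).updateCol b (fun x => A (f x) (g b)) = A.submatrix f g := by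
      ext x y
      rw [Matrix.updateCol_apply]
      split_ifs with hy
      · subst hy; rfl
      · rfl
    have hrep : (A.submatrix f g).updateCol b (fun x => A (f x) i) =
        A.submatrix f (Function.update g b i) := by
      ext x y
      rw [Matrix.updateCol_apply]
      by_cases hy : y = b
      · subst hy; simp
      · simp [hy]
    rw [hcol, Matrix.det_updateCol_add, Matrix.det_updateCol_smul, hself, hrep]
    refine S.add_mem (hA k f g hf hg) (S.mul_mem hr ?_)
    by_cases hi : i ∈ Set.range g
    · obtain ⟨a, rfl⟩ := hi
      have hab : a ≠ b := by
        rintro rfl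
        omega
      rw [Matrix.det_zero_of_column_eq hab fun x => by simp [hab]]
      exact S.zero_mem
    · exact hA k f _ hf (hg.update_of_adjacent hi hij)
  · have hcol : (A * (1 + Matrix.single i j r)).submatrix f g = A.submatrix f g := by
      ext x y
      rw [Matrix.submatrix_apply, Matrix.mul_one_add_single_apply,
        if_neg fun hy => hj ⟨y, hy⟩, add_zero, Matrix.submatrix_apply]
    rw [hcol]
    exact hA k f g hf hg

theorem Matrix.IsTotallyNonneg.mul_one_add_single_add_single {A : Matrix (Fin N) (Fin N) R}
    (hA : A.IsTotallyNonneg S) {i j i' j' : Fin N} (hij : (i : ℕ) = j + 1 ∨ (j : ℕ) = i + 1)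
    (hij' : (i' : ℕ) = j' + 1 ∨ (j' : ℕ) = i' + 1) (hne : j ≠ i') {r : R} (hr : r ∈ S) :
    (A * (1 + (Matrix.single i j r + Matrix.single i' j' r))).IsTotallyNonneg S := by
  have h : (1 + (Matrix.single i j r + Matrix.single i' j' r) : Matrix (Fin N) (Fin N) R) =
      (1 + Matrix.single i j r) * (1 + Matrix.single i' j' r) := by
    rw [mul_add, mul_one, add_mul, one_mul, Matrix.single_mul_single_of_ne _ _ _ _ hne, add_zero,
      add_assoc]
  rw [h, ← mul_assoc]
  exact (hA.mul_one_add_single hij hr).mul_one_add_single hij' hr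

end TotallyNonneg

/-- The integer polynomials with nonnegative coefficients. -/
def MvPolynomial.nonnegCoeff (σ : Type*) : Subsemiring (MvPolynomial σ ℤ) where
  carrier := {p | ∀ d, 0 ≤ p.coeff d}
  zero_mem' d := by simp
  one_mem' d := by
    rw [MvPolynomial.coeff_one]
    split_ifs <;> simp
  add_mem' hp hq d := by
    rw [MvPolynomial.coeff_add]
    exact add_nonneg (hp d) (hq d)
  mul_mem' hp hq d := by
    rw [MvPolynomial.coeff_mul]
    exact Finset.sum_nonneg fun x _ => mul_nonneg (hp x.1) (hq x.2)

theorem MvPolynomial.X_mem_nonnegCoeff {σ : Type*} (i : σ) :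
    (MvPolynomial.X i : MvPolynomial σ ℤ) ∈ MvPolynomial.nonnegCoeff σ := by
  intro d
  rw [MvPolynomial.coeff_X]
  split_ifs <;> simp

theorem Matrix.IsTotallyNonneg.mul_one_add_smul_eC {n : ℕ} (hn : 2 ≤ n)
    {S : Subsemiring (RC n)} {A : Matrix (Fin (2 * n)) (Fin (2 * n)) (RC n)}
    (hA : A.IsTotallyNonneg S) (u : Fin n) {r : RC n} (hr : r ∈ S) :
    (A * (1 + r • eC n hn u)).IsTotallyNonneg S := by
  unfold eC
  split_ifs with h
  · rw [smul_add, Matrix.smul_single, Matrix.smul_single, smul_eq_mul, mul_one]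
    refine hA.mul_one_add_single_add_single (Or.inr rfl) (Or.inr ?_) ?_ hr
    · dsimp only
      omega
    · rw [Ne, Fin.mk.injEq]
      omega
  · rw [Matrix.smul_single, smul_eq_mul, mul_one]
    refine hA.mul_one_add_single (Or.inr ?_) hr
    dsimp only
    omega

theorem Matrix.IsTotallyNonneg.mul_one_add_transpose_eC {n : ℕ} (hn : 2 ≤ n)
    {S : Subsemiring (RC n)} {A : Matrix (Fin (2 * n)) (Fin (2 * n)) (RC n)}
    (hA : A.IsTotallyNonneg S) (u : Fin n) :
    (A * (1 + (eC n hn u)ᵀ)).IsTotallyNonneg S := by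
  unfold eC
  split_ifs with h
  · rw [Matrix.transpose_add, Matrix.transpose_single, Matrix.transpose_single]
    refine hA.mul_one_add_single_add_single (Or.inl rfl) (Or.inl ?_) ?_ S.one_mem
    · dsimp only
      omega
    · rw [Ne, Fin.mk.injEq]
      omega
  · rw [Matrix.transpose_single]
    refine hA.mul_one_add_single (Or.inl ?_) S.one_mem
    dsimp only
    omega

theorem Matrix.IsTotallyNonneg.mul_stepC {n : ℕ} (hn : 2 ≤ n) (w : Fin n ≃ Fin n)
    {A : Matrix (Fin (2 * n)) (Fin (2 * n)) (RC n)}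
    (hA : A.IsTotallyNonneg (MvPolynomial.nonnegCoeff (Fin n))) (t : Fin (2 * n)) :
    (A * stepC n hn w t).IsTotallyNonneg (MvPolynomial.nonnegCoeff (Fin n)) := by
  unfold stepC
  split_ifs with h
  · exact hA.mul_one_add_transpose_eC hn _
  · exact hA.mul_one_add_smul_eC hn _ (MvPolynomial.X_mem_nonnegCoeff _)

theorem isTotallyNonneg_MC {n : ℕ} (hn : 2 ≤ n) (w : Fin n ≃ Fin n) :
    (MC n hn w).IsTotallyNonneg (MvPolynomial.nonnegCoeff (Fin n)) := by
  have key : ∀ l : List (Fin (2 * n)),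
      ((l.map (stepC n hn w)).prod).IsTotallyNonneg (MvPolynomial.nonnegCoeff (Fin n)) := by
    intro l
    induction l using List.reverseRecOn with
    | nil => exact Matrix.isTotallyNonneg_one
    | append_singleton l t ih =>
      rw [List.map_append, List.prod_append, List.map_singleton, List.prod_singleton]
      exact ih.mul_stepC hn w t
  exact key _

theorem typeC_Fpolynomial_coefficients_nonneg
    (n : ℕ) (hn : 2 ≤ n) (w : Fin n ≃ Fin n)
    (k : ℕ) (hk1 : 1 ≤ k) (hk2 : k ≤ n) (m : ℤ)
    (I : Finset (Fin (2 * n)))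
    (hIdef : I = (initSegC (2 * n) k).image ⇑(cC n hn w ^ m))
    (hI : I.card = k) (d : Fin n →₀ ℕ) :
    0 ≤ MvPolynomial.coeff d (minorC (MC n hn w) I I hI hI) := by
  exact isTotallyNonneg_MC hn w k _ _ (I.orderEmbOfFin hI).strictMono
    (I.orderEmbOfFin hI).strictMono d
end
end

section
/- In ℤ[t_1,t_2,t_3,t_4], the minor with row set {3,8} and column set {3,8} of the 8×8 matrix M = x̄_1(1)·x̄_2(1)·x̄_3(1)·x̄_4(1)·x_4(t_4)·x_3(t_3)·x_2(t_2)·x_1(t_1) equals 1 + t_1 + t_2 + 2t_1t_2 + t_1t_2t_3 + t_1t_2t_4 + t_1t_2² + t_1t_2²t_3 + t_1t_2²t_4 + t_1t_2²t_3t_4. (Here {3,8} corresponds to {3,\bar 1} = c²({1,2}) for the Coxeter element c = s_1s_2s_3s_4 of type D_4, so this minor is the F-polynomial F_{c²ω_2} in type D_4.) -/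
/-!
Concrete type D_4 example: the minor of
M = x̄_1(1)·x̄_2(1)·x̄_3(1)·x̄_4(1)·x_4(t_4)·x_3(t_3)·x_2(t_2)·x_1(t_1)
on rows {3,8} and columns {3,8} equals
1 + t_1 + t_2 + 2t_1t_2 + t_1t_2t_3 + t_1t_2t_4 + t_1t_2² + t_1t_2²t_3 + t_1t_2²t_4 + t_1t_2²t_3t_4.
Zero-based indexing: Ω = {1,2,3,4,\bar 4,\bar 3,\bar 2,\bar 1} is identified with `Fin 8`
(so rows {3,8} are indices {2,7}), and t_j corresponds to `X (j-1)` in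
`MvPolynomial (Fin 4) ℤ`.
-/

open Matrix MvPolynomial

noncomputable section

abbrev R17 := MvPolynomial (Fin 4) ℤ

/-- `e_i` for i = 1,2,3 (zero-based `u = i-1`): `E_{u,u+1} + E_{6-u,7-u}`. -/
def e17 (u : Fin 3) : Matrix (Fin 8) (Fin 8) R17 :=
  Matrix.single ⟨u, by omega⟩ ⟨(u : ℕ) + 1, by have := u.isLt; omega⟩ 1 +
  Matrix.single ⟨6 - (u : ℕ), by omega⟩ ⟨7 - (u : ℕ), by omega⟩ 1

/-- `e_4 = E_{3,\bar 4} + E_{4,\bar 3}` (zero-based: `E_{2,4} + E_{3,5}`). -/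
def e17' : Matrix (Fin 8) (Fin 8) R17 :=
  Matrix.single 2 4 1 + Matrix.single 3 5 1

/-- `x_i(r) = Id + r·e_i` for i = 1,2,3. -/
def x17 (u : Fin 3) (r : R17) : Matrix (Fin 8) (Fin 8) R17 := 1 + r • e17 u

/-- `x̄_i(r) = Id + r·e_iᵀ` for i = 1,2,3. -/
def xbar17 (u : Fin 3) (r : R17) : Matrix (Fin 8) (Fin 8) R17 := 1 + r • (e17 u)ᵀ

/-- `x_4(r) = Id + r·e_4`. -/
def x17' (r : R17) : Matrix (Fin 8) (Fin 8) R17 := 1 + r • e17'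

/-- `x̄_4(r) = Id + r·e_4ᵀ`. -/
def xbar17' (r : R17) : Matrix (Fin 8) (Fin 8) R17 := 1 + r • e17'ᵀ

/-- `M = x̄_1(1)·x̄_2(1)·x̄_3(1)·x̄_4(1)·x_4(t_4)·x_3(t_3)·x_2(t_2)·x_1(t_1)`. -/
def M17 : Matrix (Fin 8) (Fin 8) R17 :=
  xbar17 0 1 * xbar17 1 1 * xbar17 2 1 * xbar17' 1 *
    x17' (X 3) * x17 2 (X 2) * x17 1 (X 1) * x17 0 (X 0)

/-- Right multiplication by `1 + r • (E_{a,b} + E_{c,d})` adds `r` times columns `a` and `c`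
to columns `b` and `d` respectively. -/
theorem mul_one_add_smul_single_add_single_apply {n R : Type*} [Fintype n] [DecidableEq n]
    [CommRing R] (A : Matrix n n R) (r : R) (a b c d i j : n) :
    (A * (1 + r • (Matrix.single a b 1 + Matrix.single c d 1)) : Matrix n n R) i j =
      A i j + r * ((if j = b then A i a else 0) + (if j = d then A i c else 0)) := by
  have h (p q : n) : (A * Matrix.single p q 1 : Matrix n n R) i j = if j = q then A i p else 0 := by
    split_ifs with hj
    · subst hj
      simp
    · simp [Matrix.mul_single_apply_of_ne, hj]
  rw [Matrix.mul_add, Matrix.mul_one, Matrix.mul_smul, Matrix.mul_add, Matrix.add_apply,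
    Matrix.smul_apply, Matrix.add_apply, h, h, smul_eq_mul]

theorem typeD4_Fpolynomial_example :
    Matrix.det !![M17 2 2, M17 2 7; M17 7 2, M17 7 7] =
      1 + X 0 + X 1 + 2 * (X 0 * X 1) + X 0 * X 1 * X 2 + X 0 * X 1 * X 3 +
        X 0 * X 1 ^ 2 + X 0 * X 1 ^ 2 * X 2 + X 0 * X 1 ^ 2 * X 3 +
        X 0 * X 1 ^ 2 * X 2 * X 3 := by
  rw [← Matrix.one_mul M17]
  simp only [M17, x17, xbar17, x17', xbar17', e17, e17', Matrix.transpose_add,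
    Matrix.transpose_single, ← Matrix.mul_assoc, mul_one_add_smul_single_add_single_apply,
    Matrix.det_fin_two_of]
  simp [Fin.ext_iff, Matrix.one_apply]
  ring
end
end
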